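/- arXiv:math/0312253 — 2 statements merged into one kernel-verified Lean document; each statement's English description precedes it below -/
import Mathlib

section
/- Fix d ≥ 1, let P ⊆ EuclideanSpace ℝ (Fin (d+1)) be a convex polytope with nonempty interior, and let S = frontier P. Let w ∈ S lie in a face of P of dimension at most d−2, and let [a₀, w] ⊆ S and [w, b₀] ⊆ S be nondegenerate straight segments (a₀ ≠ w and b₀ ≠ w) such that no face of P of dimension d contains both segments. Then there exists δ > 0 such that for all a on the segment [a₀, w] and all b on the segment [w, b₀] with 0 < ‖a − w‖ < δ and 0 < ‖b − w‖ < δ, the intrinsic distance satisfies μ(a, b) < ‖a − w‖ + ‖w − b‖; in particular, the path from a through w to b along the two segments is not a shortest path in S. (Lemma 1.2 of the paper.) -/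
open scoped RealInnerProductSpace ENNReal

/-- A path in `S` from `a` to `b`: a continuous map `γ` on `[0,1]` with
`γ 0 = a`, `γ 1 = b`, and image contained in `S`. -/
def IsPathIn {E : Type*} [NormedAddCommGroup E] [InnerProductSpace ℝ E]
    (S : Set E) (a b : E) (γ : ℝ → E) : Prop :=
  ContinuousOn γ (Set.Icc 0 1) ∧ γ 0 = a ∧ γ 1 = b ∧ Set.MapsTo γ (Set.Icc 0 1) S

/-- The length of a path: its total variation on `[0,1]`. -/
noncomputable def pathLength {E : Type*} [NormedAddCommGroup E] [InnerProductSpace ℝ E]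
    (γ : ℝ → E) : ℝ≥0∞ :=
  eVariationOn γ (Set.Icc 0 1)

/-- The intrinsic distance in `S`: the infimum of lengths of paths in `S`
from `a` to `b`. -/
noncomputable def intrinsicDist {E : Type*} [NormedAddCommGroup E] [InnerProductSpace ℝ E]
    (S : Set E) (a b : E) : ℝ≥0∞ :=
  ⨅ (γ : ℝ → E) (_ : IsPathIn S a b γ), pathLength γ

/-- A shortest path in `S` from `a` to `b`: a path in `S` from `a` to `b` whose
length equals the intrinsic distance `μ(a,b)`. -/
def IsShortestPath {E : Type*} [NormedAddCommGroup E] [InnerProductSpace ℝ E]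
    (S : Set E) (a b : E) (γ : ℝ → E) : Prop :=
  IsPathIn S a b γ ∧ pathLength γ = intrinsicDist S a b

/-- A face of `P`: a nonempty convex subset of `P` that is extreme in `P`. -/
def IsFace {E : Type*} [NormedAddCommGroup E] [InnerProductSpace ℝ E]
    (P F : Set E) : Prop :=
  F.Nonempty ∧ Convex ℝ F ∧ IsExtreme ℝ P F

/-- The dimension of a face: the dimension of its affine span. -/
noncomputable def faceDim {E : Type*} [NormedAddCommGroup E] [InnerProductSpace ℝ E]
    (F : Set E) : ℕ :=
  Module.finrank ℝ (affineSpan ℝ F).direction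

section MetricPart

variable {E : Type*} [NormedAddCommGroup E] [InnerProductSpace ℝ E]

/-- A closed convex set admits a nonexpansive retraction that sends every point outside its
interior to its boundary. -/
theorem exists_nonexpansive_retraction [CompleteSpace E] {P : Set E} (hne : P.Nonempty)
    (hcl : IsClosed P) (hconv : Convex ℝ P) :
    ∃ r : E → E, LipschitzWith 1 r ∧ (∀ x ∈ P, r x = x) ∧
      ∀ x, x ∉ interior P → r x ∈ frontier P := by
  choose r hrP hr using exists_norm_eq_iInf_of_complete_convex hne hcl.isComplete hconv
  have hvar : ∀ x, ∀ z ∈ P, ⟪x - r x, z - r x⟫ ≤ 0 := fun x =>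
    (norm_eq_iInf_iff_real_inner_le_zero hconv (hrP x)).1 (hr x)
  refine ⟨r, LipschitzWith.of_dist_le_mul fun x y => ?_, fun x hx => ?_, fun x hx => ?_⟩
  · have h1 := hvar x _ (hrP y)
    have h2 := hvar y _ (hrP x)
    have h3 : ‖r x - r y‖ ^ 2 ≤ ⟪x - y, r x - r y⟫ := by
      rw [← real_inner_self_eq_norm_sq]
      simp only [inner_sub_left, inner_sub_right] at h1 h2 ⊢
      linarith
    have h4 := real_inner_le_norm (x - y) (r x - r y)
    simp only [dist_eq_norm, NNReal.coe_one, one_mul]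
    by_contra! h
    have := norm_nonneg (x - y)
    nlinarith [norm_nonneg (r x - r y)]
  · have := hvar x x hx
    rw [real_inner_self_eq_norm_sq] at this
    have h0 : ‖x - r x‖ = 0 := by nlinarith [norm_nonneg (x - r x)]
    exact (sub_eq_zero.1 (norm_eq_zero.1 h0)).symm
  · refine ⟨subset_closure (hrP x), fun hint => ?_⟩
    have hcont : Filter.Tendsto (fun t : ℝ => r x + t • (x - r x)) (nhdsWithin 0 (Set.Ioi 0))
        (nhds (r x)) := by
      have : Continuous (fun t : ℝ => r x + t • (x - r x)) := by fun_prop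
      simpa using (this.tendsto 0).mono_left nhdsWithin_le_nhds
    obtain ⟨t, htP, ht⟩ := ((hcont.eventually (mem_interior_iff_mem_nhds.1 hint)).and
      self_mem_nhdsWithin).exists
    have := hvar x _ htP
    rw [add_sub_cancel_left, real_inner_smul_right, real_inner_self_eq_norm_sq] at this
    have ht' : (0 : ℝ) < t := ht
    have h0 : ‖x - r x‖ = 0 := by
      by_contra hne
      have : 0 < ‖x - r x‖ ^ 2 := by positivity
      nlinarith
    rw [← sub_eq_zero.1 (norm_eq_zero.1 h0)] at hint
    exact hx hint

theorem intrinsicDist_triangle (S : Set E) (a b c : E) :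
    intrinsicDist S a c ≤ intrinsicDist S a b + intrinsicDist S b c := by
  simp only [intrinsicDist, ENNReal.iInf_add, ENNReal.add_iInf]
  refine le_iInf fun η => le_iInf fun hη => le_iInf fun γ => le_iInf fun hγ => ?_
  obtain ⟨hγc, hγ0, hγ1, hγS⟩ := hγ
  obtain ⟨hηc, hη0, hη1, hηS⟩ := hη
  set κ : ℝ → E := fun t => if t ≤ 1 / 2 then γ (2 * t) else η (2 * t - 1) with hκ
  have hleft : Set.EqOn κ (γ ∘ fun t => 2 * t) (Set.Icc 0 (1 / 2)) := fun t ht => by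
    simp only [hκ, if_pos ht.2, Function.comp]
  have hright : Set.EqOn κ (η ∘ fun t => 2 * t - 1) (Set.Icc (1 / 2) 1) := fun t ht => by
    rcases ht.1.eq_or_lt with h | h
    · subst h
      simp [hκ, hη0, hγ1]
    · simp only [hκ, if_neg (not_le.2 h), Function.comp]
  have hmapl : Set.MapsTo (fun t : ℝ => 2 * t) (Set.Icc 0 (1 / 2)) (Set.Icc 0 1) :=
    fun t ht => ⟨by linarith [ht.1], by linarith [ht.2]⟩
  have hmapr : Set.MapsTo (fun t : ℝ => 2 * t - 1) (Set.Icc (1 / 2) 1) (Set.Icc 0 1) :=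
    fun t ht => ⟨by linarith [ht.1], by linarith [ht.2]⟩
  have hunion : Set.Icc (0 : ℝ) (1 / 2) ∪ Set.Icc (1 / 2) 1 = Set.Icc 0 1 :=
    Set.Icc_union_Icc_eq_Icc (by norm_num) (by norm_num)
  have hpath : IsPathIn S a c κ := by
    refine ⟨?_, ?_, ?_, ?_⟩
    · rw [← hunion]
      refine ContinuousOn.union_of_isClosed ?_ ?_ isClosed_Icc isClosed_Icc
      · exact (hγc.comp (by fun_prop) hmapl).congr hleft
      · exact (hηc.comp (by fun_prop) hmapr).congr hright
    · rw [hleft ⟨le_rfl, by norm_num⟩]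
      simpa using hγ0
    · rw [hright ⟨by norm_num, le_rfl⟩]
      norm_num [hη1]
    · rw [← hunion]
      rintro t (ht | ht)
      · rw [hleft ht]
        exact hγS (hmapl ht)
      · rw [hright ht]
        exact hηS (hmapr ht)
  refine (iInf₂_le κ hpath).trans ?_
  have hadd := eVariationOn.Icc_add_Icc κ (s := Set.univ) (a := 0) (b := 1 / 2) (c := 1)
    (by norm_num) (by norm_num) trivial
  simp only [Set.univ_inter] at hadd
  rw [pathLength, ← hadd, eVariationOn.eq_of_eqOn hleft, eVariationOn.eq_of_eqOn hright]
  refine add_le_add ?_ ?_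
  · exact eVariationOn.comp_le_of_monotoneOn _ _ (fun s _ t _ h => by simpa using h) hmapl
  · exact eVariationOn.comp_le_of_monotoneOn _ _ (fun s _ t _ h => by simpa using h) hmapr

/-- If a `1`-Lipschitz map sends a segment into `S`, the images of its endpoints are at intrinsic
distance at most the length of the segment. -/
theorem intrinsicDist_le_of_lipschitz {S : Set E} {r : E → E} (hr : LipschitzWith 1 r) {x y : E}
    (hxy : ∀ z ∈ segment ℝ x y, r z ∈ S) :
    intrinsicDist S (r x) (r y) ≤ ENNReal.ofReal ‖x - y‖ := by
  set ℓ : ℝ → E := fun t => AffineMap.lineMap x y t with hℓ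
  have hlip : LipschitzWith ‖x - y‖₊ ℓ := by
    refine LipschitzWith.of_dist_le_mul fun s t => ?_
    simp only [hℓ, dist_lineMap_lineMap, coe_nnnorm, dist_eq_norm x y, mul_comm, le_refl]
  have hmap : ∀ t ∈ Set.Icc (0 : ℝ) 1, r (ℓ t) ∈ S := fun t ht =>
    hxy _ (by rw [segment_eq_image_lineMap]; exact ⟨t, ht, rfl⟩)
  have hpath : IsPathIn S (r x) (r y) (r ∘ ℓ) :=
    ⟨(hr.continuous.comp hlip.continuous).continuousOn, by simp [hℓ], by simp [hℓ], hmap⟩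
  refine (iInf₂_le _ hpath).trans ?_
  have hc : LipschitzWith ‖x - y‖₊ (r ∘ ℓ) := by simpa using hr.comp hlip
  have h1 := (hc.lipschitzOnWith (s := Set.Icc 0 1)).comp_eVariationOn_le
    (g := id) (s := Set.Icc (0 : ℝ) 1) (Set.mapsTo_id _)
  have h2 : eVariationOn (id : ℝ → ℝ) (Set.Icc 0 1) ≤ 1 := by
    have := MonotoneOn.eVariationOn_eq (f := (id : ℝ → ℝ)) (s := Set.Icc (0 : ℝ) 1)
      (monotone_id.monotoneOn _) (a := 0) (b := 1) (by simp) (by simp)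
    simp_all
  rw [pathLength]
  calc eVariationOn (r ∘ ℓ) (Set.Icc 0 1) ≤ ‖x - y‖₊ * eVariationOn id (Set.Icc (0 : ℝ) 1) := h1
    _ ≤ ‖x - y‖₊ * 1 := by gcongr
    _ = ENNReal.ofReal ‖x - y‖ := by rw [mul_one, ofReal_norm, enorm_eq_nnnorm]

theorem intrinsicDist_frontier_le_of_polyline [CompleteSpace E] {P : Set E} (hcl : IsClosed P)
    (hconv : Convex ℝ P) {a b p q : E} (ha : a ∈ P) (hb : b ∈ P)
    (hap : Disjoint (segment ℝ a p) (interior P)) (hpq : Disjoint (segment ℝ p q) (interior P))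
    (hqb : Disjoint (segment ℝ q b) (interior P)) :
    intrinsicDist (frontier P) a b ≤ ENNReal.ofReal (‖a - p‖ + ‖p - q‖ + ‖q - b‖) := by
  obtain ⟨r, hr, hfix, hfr⟩ := exists_nonexpansive_retraction ⟨a, ha⟩ hcl hconv
  have key : ∀ {x y : E}, Disjoint (segment ℝ x y) (interior P) →
      intrinsicDist (frontier P) (r x) (r y) ≤ ENNReal.ofReal ‖x - y‖ := fun h =>
    intrinsicDist_le_of_lipschitz hr fun z hz => hfr z (Set.disjoint_left.1 h hz)
  rw [ENNReal.ofReal_add (by positivity) (by positivity),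
    ENNReal.ofReal_add (by positivity) (by positivity)]
  have h := (intrinsicDist_triangle (frontier P) (r a) (r q) (r b)).trans
    (add_le_add_left (intrinsicDist_triangle (frontier P) (r a) (r p) (r q)) _)
  rw [hfix a ha, hfix b hb] at h
  refine h.trans (add_le_add (add_le_add ?_ (key hpq)) ?_)
  · simpa [hfix a ha] using key hap
  · simpa [hfix b hb] using key hqb

theorem norm_sub_smul_le {u p : E} (hu : u ≠ 0) (c : ℝ) :
    ‖u - c • p‖ ≤ ‖u‖ - c * (⟪u, p⟫ / ‖u‖) + c ^ 2 * (‖p‖ ^ 2 / (2 * ‖u‖)) := by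
  have hpos : 0 < ‖u‖ := norm_pos_iff.2 hu
  have hsq : ‖u - c • p‖ ^ 2 = ‖u‖ ^ 2 - 2 * (c * ⟪u, p⟫) + c ^ 2 * ‖p‖ ^ 2 := by
    rw [norm_sub_sq_real, real_inner_smul_right, norm_smul, mul_pow, Real.norm_eq_abs, sq_abs]
  have hrhs : ‖u‖ - c * (⟪u, p⟫ / ‖u‖) + c ^ 2 * (‖p‖ ^ 2 / (2 * ‖u‖)) =
      (‖u - c • p‖ ^ 2 + ‖u‖ ^ 2) / (2 * ‖u‖) := by
    rw [hsq]
    field_simp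
    ring
  rw [hrhs, le_div_iff₀ (by positivity)]
  nlinarith [sq_nonneg (‖u - c • p‖ - ‖u‖)]

/-- First variation of length: moving the corner `0` of the broken line `u, 0, v` to the segment
`c • p, c • q` shortens it for small `c`. -/
theorem exists_shorter_polyline {u v p q : E} (hu : u ≠ 0) (hv : v ≠ 0)
    (h : ‖p - q‖ < ⟪u, p⟫ / ‖u‖ + ⟪v, q⟫ / ‖v‖) :
    ∃ c > (0 : ℝ), ‖u - c • p‖ + ‖c • p - c • q‖ + ‖c • q - v‖ < ‖u‖ + ‖v‖ := by
  set K := ‖p‖ ^ 2 / (2 * ‖u‖) + ‖q‖ ^ 2 / (2 * ‖v‖) with hK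
  set D := ⟪u, p⟫ / ‖u‖ + ⟪v, q⟫ / ‖v‖ - ‖p - q‖ with hD
  have hK0 : 0 ≤ K := by positivity
  have hD0 : 0 < D := by linarith
  refine ⟨D / (K + 1), by positivity, ?_⟩
  set c := D / (K + 1) with hc
  have hc0 : 0 < c := by positivity
  have hcK : c * (K + 1) = D := div_mul_cancel₀ _ (by positivity)
  have h1 := norm_sub_smul_le (p := p) hu c
  have h2 := norm_sub_smul_le (p := q) hv c
  have h3 : ‖c • p - c • q‖ = c * ‖p - q‖ := by
    rw [← smul_sub, norm_smul, Real.norm_eq_abs, abs_of_pos hc0]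
  rw [norm_sub_rev (c • q) v, h3]
  have h4 : c * K < D := by linarith
  have h5 := mul_lt_mul_of_pos_left h4 hc0
  rw [hK, hD] at h5
  linarith

end MetricPart

section InnerNormals

variable {E : Type*} [NormedAddCommGroup E] [InnerProductSpace ℝ E]

/-- `h` is an inner normal vector of `P` at `w`: the half-space
`{x | 0 ≤ ⟪h, x - w⟫}` contains `P`. -/
def IsInnerNormal (P : Set E) (w h : E) : Prop :=
  ∀ x ∈ P, 0 ≤ ⟪h, x - w⟫

theorem convex_setOf_inner_sub_nonneg (w h : E) : Convex ℝ {x : E | 0 ≤ ⟪h, x - w⟫} := by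
  have : {x : E | 0 ≤ ⟪h, x - w⟫} = {x : E | ⟪h, w⟫ ≤ innerₛₗ ℝ h x} := by
    ext x
    simp [inner_sub_right]
  rw [this]
  exact convex_halfSpace_ge (innerₛₗ ℝ h).isLinear _

theorem isInnerNormal_convexHull {A : Set E} {w h : E}
    (hA : ∀ x ∈ A, 0 ≤ ⟪h, x - w⟫) : IsInnerNormal (convexHull ℝ A) w h :=
  convexHull_min hA (convex_setOf_inner_sub_nonneg w h)

theorem IsInnerNormal.inner_pos {P : Set E} {w h : E} (hh : IsInnerNormal P w h) (h0 : h ≠ 0)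
    {x : E} (hx : x ∈ interior P) : 0 < ⟪h, x - w⟫ := by
  have hcont : Filter.Tendsto (fun t : ℝ => x - t • h) (nhdsWithin 0 (Set.Ioi 0)) (nhds x) := by
    have : Continuous (fun t : ℝ => x - t • h) := by fun_prop
    simpa using (this.tendsto 0).mono_left nhdsWithin_le_nhds
  obtain ⟨t, htP, ht⟩ := ((hcont.eventually (mem_interior_iff_mem_nhds.1 hx)).and
    self_mem_nhdsWithin).exists
  have ht' : (0 : ℝ) < t := ht
  have h1 := hh _ htP
  rw [sub_right_comm, inner_sub_right, real_inner_smul_right, real_inner_self_eq_norm_sq] at h1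
  have : 0 < ‖h‖ := norm_pos_iff.2 h0
  have : 0 < t * ‖h‖ ^ 2 := by positivity
  linarith

theorem IsInnerNormal.disjoint_segment_interior {P : Set E} {w h : E} (hh : IsInnerNormal P w h)
    (h0 : h ≠ 0) {x y : E} (hx : ⟪h, x - w⟫ ≤ 0) (hy : ⟪h, y - w⟫ ≤ 0) :
    Disjoint (segment ℝ x y) (interior P) := by
  rw [Set.disjoint_left]
  intro z hz hzP
  have hconv := convex_setOf_inner_sub_nonneg w (-h)
  have := hconv.segment_subset (x := x) (y := y) (by simpa using hx) (by simpa using hy) hz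
  have h1 := hh.inner_pos h0 hzP
  simp only [Set.mem_ofPred_eq, inner_neg_left] at this
  linarith

/-- A segment in the boundary of a convex body has a common nonzero inner normal. -/
theorem exists_isInnerNormal_of_segment_subset_frontier [CompleteSpace E] {P : Set E}
    (hconv : Convex ℝ P) (hcl : IsClosed P) (hint : (interior P).Nonempty) {a w : E}
    (hseg : segment ℝ a w ⊆ frontier P) :
    ∃ f : E, f ≠ 0 ∧ IsInnerNormal P w f ∧ ⟪f, a - w⟫ = 0 := by
  have hsegP : segment ℝ a w ⊆ P := hseg.trans hcl.frontier_subset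
  have hmid : midpoint ℝ a w ∉ interior P := (hseg (midpoint_mem_segment a w)).2
  obtain ⟨φ, hφ0, hφ⟩ := geometric_hahn_banach_of_nonempty_interior_point hconv hmid hint
  have hinner : ∀ x, ⟪(InnerProductSpace.toDual ℝ E).symm φ, x⟫ = φ x := fun x =>
    InnerProductSpace.toDual_symm_apply
  have h1 := hφ a (hsegP (left_mem_segment ℝ a w))
  have h2 := hφ w (hsegP (right_mem_segment ℝ a w))
  have hm : φ (midpoint ℝ a w) = (φ a + φ w) / 2 := by
    rw [midpoint_eq_smul_add, map_smul, map_add, smul_eq_mul, invOf_eq_inv]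
    ring
  refine ⟨-(InnerProductSpace.toDual ℝ E).symm φ, by simpa using hφ0, fun x hx => ?_, ?_⟩
  · have := hφ x hx
    rw [inner_neg_left, hinner, map_sub]
    linarith
  · rw [inner_neg_left, hinner, map_sub]
    linarith

theorem exists_pos_mul_add_pos {ι : Type*} (A : Finset ι) (φ ψ : ι → ℝ) :
    ∃ C > (0 : ℝ), ∀ x ∈ A, 0 < φ x → 0 < C * φ x + ψ x := by
  have hnn : ∀ x ∈ A, 0 ≤ |ψ x| / |φ x| := fun x _ => by positivity
  refine ⟨1 + ∑ x ∈ A, |ψ x| / |φ x|, by linarith [Finset.sum_nonneg hnn], fun x hx hφ => ?_⟩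
  have h1 := Finset.single_le_sum hnn hx
  have h2 : |ψ x| / |φ x| * φ x = |ψ x| := by
    rw [abs_of_pos hφ, div_mul_cancel₀ _ hφ.ne']
  have h3 := mul_le_mul_of_nonneg_right h1 hφ.le
  have := neg_abs_le (ψ x)
  linarith

/-- An inner normal of a polytope can be perturbed by any vector that is nonnegative on the face
it supports. -/
theorem IsInnerNormal.exists_smul_add {A : Finset E} {w h k : E}
    (hh : IsInnerNormal (convexHull ℝ (A : Set E)) w h)
    (hk : ∀ x ∈ A, ⟪h, x - w⟫ = 0 → 0 ≤ ⟪k, x - w⟫) :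
    ∃ C > (0 : ℝ), IsInnerNormal (convexHull ℝ (A : Set E)) w (C • h + k) ∧
      ∀ x ∈ A, 0 < ⟪h, x - w⟫ → 0 < ⟪C • h + k, x - w⟫ := by
  obtain ⟨C, hC, hCA⟩ := exists_pos_mul_add_pos A (fun x => ⟪h, x - w⟫) (fun x => ⟪k, x - w⟫)
  have hpos : ∀ x ∈ A, 0 < ⟪h, x - w⟫ → 0 < ⟪C • h + k, x - w⟫ := fun x hx hx' => by
    rw [inner_add_left, real_inner_smul_left]
    exact hCA x hx hx'
  refine ⟨C, hC, isInnerNormal_convexHull fun x hx => ?_, hpos⟩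
  rcases (hh x (subset_convexHull ℝ _ hx)).eq_or_lt with h0 | h0
  · rw [inner_add_left, real_inner_smul_left, ← h0, mul_zero, zero_add]
    exact hk x hx h0.symm
  · exact (hpos x hx h0).le

/-- The span of the directions from `w` to the points of `A` on which `h` is constant. -/
def contactSpan (A : Finset E) (w h : E) : Submodule ℝ E :=
  Submodule.span ℝ {y | ∃ x ∈ A, ⟪h, x - w⟫ = 0 ∧ x - w = y}

theorem sub_mem_contactSpan {A : Finset E} {w h x : E} (hx : x ∈ A) (h0 : ⟪h, x - w⟫ = 0) :
    x - w ∈ contactSpan A w h :=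
  Submodule.subset_span ⟨x, hx, h0, rfl⟩

variable [FiniteDimensional ℝ E]

/-- Farkas-type lemma: a direction orthogonal to all inner normals of a polytope at `w` can be
followed from `w` inside the polytope. -/
theorem exists_add_smul_mem_convexHull {A : Finset E} {w ℓ : E}
    (hw : w ∈ convexHull ℝ (A : Set E))
    (hℓ : ∀ h, IsInnerNormal (convexHull ℝ (A : Set E)) w h → ⟪h, ℓ⟫ = 0) :
    ∃ ε > (0 : ℝ), w + ε • ℓ ∈ convexHull ℝ (A : Set E) := by
  classical
  set P := convexHull ℝ (A : Set E) with hP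
  -- an inner normal that is positive on as many points of `A` as possible
  obtain ⟨h, hh, hmax⟩ : ∃ h, IsInnerNormal P w h ∧ ∀ h', IsInnerNormal P w h' →
      (A.filter fun x => 0 < ⟪h', x - w⟫).card ≤ (A.filter fun x => 0 < ⟪h, x - w⟫).card := by
    have hbdd : BddAbove ((fun h => (A.filter fun x => 0 < ⟪h, x - w⟫).card) ''
        {h | IsInnerNormal P w h}) := by
      refine ⟨A.card, ?_⟩
      rintro _ ⟨h, -, rfl⟩
      exact Finset.card_filter_le _ _
    obtain ⟨h, hh, hmax⟩ := Nat.sSup_mem (Set.Nonempty.image _ ⟨0, fun x _ => by simp⟩) hbdd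
    exact ⟨h, hh, fun h' hh' => (le_csSup hbdd ⟨h', hh', rfl⟩).trans hmax.ge⟩
  set M := contactSpan A w h with hM
  have hperp : ∀ k ∈ Mᗮ, ⟪k, ℓ⟫ = 0 := fun k hk => by
    obtain ⟨C, hC, hCk, -⟩ := hh.exists_smul_add (k := k) fun x hx h0 =>
      (Submodule.inner_left_of_mem_orthogonal (sub_mem_contactSpan hx h0) hk).ge
    have := hℓ _ hCk
    rwa [inner_add_left, real_inner_smul_left, hℓ h hh, mul_zero, zero_add] at this
  have hℓM : ℓ ∈ M := by
    rw [← M.orthogonal_orthogonal]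
    exact hperp
  set B : Set M := {y | ∃ x ∈ A, ⟪h, x - w⟫ = 0 ∧ x - w = y} with hB
  have hBspan : Submodule.span ℝ B = ⊤ := by
    rw [← Submodule.map_injective_of_injective M.injective_subtype |>.eq_iff, Submodule.map_span,
      Submodule.map_top, Submodule.range_subtype]
    change _ = Submodule.span ℝ _
    congr 1
    ext y
    constructor
    · rintro ⟨y, hy, rfl⟩
      exact hy
    · rintro ⟨x, hx, h0, rfl⟩
      exact ⟨⟨x - w, sub_mem_contactSpan hx h0⟩, ⟨x, hx, h0, rfl⟩, rfl⟩
  set C := convexHull ℝ (insert 0 B) with hC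
  have hCint : (interior C).Nonempty := by
    rw [hC, interior_convexHull_nonempty_iff_affineSpan_eq_top]
    rw [← AffineSubspace.coe_eq_univ_iff, affineSpan_insert_zero, hBspan]
    rfl
  have h0int : (0 : M) ∈ interior C := by
    by_contra h0
    obtain ⟨φ, hφ0, hφ⟩ := geometric_hahn_banach_of_nonempty_interior_point
      (convex_convexHull ℝ (insert 0 B)) h0 hCint
    set k : M := -(InnerProductSpace.toDual ℝ M).symm φ with hk
    have hk_inner : ∀ y : M, ⟪(k : E), (y : E)⟫ = -φ y := fun y => by
      rw [← Submodule.coe_inner, hk, inner_neg_left, InnerProductSpace.toDual_symm_apply]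
    have hφB : ∀ y ∈ B, φ y ≤ 0 := fun y hy => by
      simpa using hφ y (subset_convexHull ℝ _ (Set.mem_insert_of_mem _ hy))
    obtain ⟨D, hD, hDn, hDpos⟩ := hh.exists_smul_add (k := (k : E)) fun x hx h0 => by
      have := hk_inner ⟨x - w, sub_mem_contactSpan hx h0⟩
      rw [this, neg_nonneg]
      exact hφB _ ⟨x, hx, h0, rfl⟩
    obtain ⟨y, hyB, hy⟩ : ∃ y ∈ B, φ y ≠ 0 := by
      by_contra! hall
      refine hφ0 (ContinuousLinearMap.coe_injective (LinearMap.ext_on hBspan ?_))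
      intro y hy
      simpa using hall y hy
    obtain ⟨x, hx, hx0, hxy⟩ := hyB
    have hxpos : 0 < ⟪D • h + (k : E), x - w⟫ := by
      rw [inner_add_left, real_inner_smul_left, hx0, hxy, hk_inner, mul_zero, zero_add, neg_pos]
      exact lt_of_le_of_ne (hφB y ⟨x, hx, hx0, hxy⟩) hy
    refine (hmax _ hDn).not_gt (Finset.card_lt_card ?_)
    rw [Finset.ssubset_iff_of_subset]
    · refine ⟨x, ?_, ?_⟩ <;> simp [hx, hxpos, hx0]
    · intro z hz
      rw [Finset.mem_filter] at hz ⊢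
      exact ⟨hz.1, hDpos z hz.1 hz.2⟩
  have hCP : ∀ y ∈ C, w + (y : E) ∈ P := by
    have hconv : Convex ℝ {y : M | w + (y : E) ∈ P} := by
      have := ((convex_convexHull ℝ (A : Set E)).translate_preimage_right w).linear_preimage
        M.subtype
      simpa [Set.preimage] using this
    refine fun y hy => convexHull_min ?_ hconv hy
    rintro z (rfl | ⟨x, hx, -, hxz⟩)
    · simpa using hw
    · rw [Set.mem_ofPred_eq, ← hxz, add_sub_cancel]
      exact subset_convexHull ℝ _ hx
  have hcont : Filter.Tendsto (fun t : ℝ => t • (⟨ℓ, hℓM⟩ : M)) (nhdsWithin 0 (Set.Ioi 0))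
      (nhds 0) := by
    have : Continuous (fun t : ℝ => t • (⟨ℓ, hℓM⟩ : M)) := by fun_prop
    simpa using (this.tendsto 0).mono_left nhdsWithin_le_nhds
  obtain ⟨t, htC, ht⟩ := ((hcont.eventually (mem_interior_iff_mem_nhds.1 h0int)).and
    self_mem_nhdsWithin).exists
  exact ⟨t, ht, hCP _ htC⟩

/-- Every boundary point of a full-dimensional polytope has an inner normal that supports a
facet. -/
theorem exists_isInnerNormal_finrank_contactSpan {A : Finset E} {w : E} {d : ℕ}
    (hd : Module.finrank ℝ E = d + 1) (hint : (interior (convexHull ℝ (A : Set E))).Nonempty)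
    (hw : w ∈ frontier (convexHull ℝ (A : Set E))) :
    ∃ f, f ≠ 0 ∧ IsInnerNormal (convexHull ℝ (A : Set E)) w f ∧
      Module.finrank ℝ (contactSpan A w f) = d := by
  set P := convexHull ℝ (A : Set E) with hP
  have hcl : IsClosed P := A.finite_toSet.isClosed_convexHull ℝ
  have hbdd : BddAbove ((fun f => Module.finrank ℝ (contactSpan A w f)) ''
      {f | f ≠ 0 ∧ IsInnerNormal P w f}) := by
    refine ⟨d + 1, ?_⟩
    rintro _ ⟨f, -, rfl⟩
    exact (Submodule.finrank_le _).trans hd.le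
  obtain ⟨f₀, hf₀, hf₀n, -⟩ := exists_isInnerNormal_of_segment_subset_frontier
    (convex_convexHull ℝ (A : Set E)) hcl hint (a := w) (w := w) (by simpa using hw)
  obtain ⟨f, ⟨hf0, hf⟩, hmax⟩ := Nat.sSup_mem (Set.Nonempty.image _ ⟨f₀, And.intro hf₀ hf₀n⟩) hbdd
  refine ⟨f, hf0, hf, ?_⟩
  have hmax' : ∀ f', f' ≠ 0 → IsInnerNormal P w f' →
      Module.finrank ℝ (contactSpan A w f') ≤ Module.finrank ℝ (contactSpan A w f) :=
    fun f' h0 h1 => (le_csSup hbdd ⟨f', ⟨h0, h1⟩, rfl⟩).trans hmax.ge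
  by_contra hne
  set M := contactSpan A w f with hM
  have hMf : M ≤ (ℝ ∙ f)ᗮ := by
    refine Submodule.span_le.2 ?_
    rintro _ ⟨x, -, h0, rfl⟩
    exact Submodule.mem_orthogonal_singleton_iff_inner_right.2 h0
  have hfd : Module.finrank ℝ (ℝ ∙ f)ᗮ = d := by
    have : Fact (Module.finrank ℝ E = d + 1) := ⟨hd⟩
    exact Submodule.finrank_orthogonal_span_singleton hf0
  have hlt : M < (ℝ ∙ f)ᗮ := by
    refine lt_of_le_of_ne hMf fun h => hne ?_
    rw [h, hfd]
  -- a direction in which the supporting hyperplane can be tilted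
  obtain ⟨g, hgM, hgf, hg0⟩ : ∃ g ∈ Mᗮ, ⟪f, g⟫ = 0 ∧ g ≠ 0 := by
    have hfin := Submodule.finrank_add_inf_finrank_orthogonal hlt.le
    have hfin' := Submodule.finrank_lt_finrank_of_lt hlt
    have hpos : 0 < Module.finrank ℝ (Mᗮ ⊓ (ℝ ∙ f)ᗮ : Submodule ℝ E) := by omega
    obtain ⟨g, hg, hg0⟩ := Submodule.exists_mem_ne_zero_of_ne_bot
      (Submodule.one_le_finrank_iff.1 hpos)
    exact ⟨g, hg.1, Submodule.mem_orthogonal_singleton_iff_inner_right.1 hg.2, hg0⟩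
  obtain ⟨g, hgM, hgf, x₁, hx₁, hgx₁⟩ : ∃ g ∈ Mᗮ, ⟪f, g⟫ = 0 ∧ ∃ x ∈ A, ⟪g, x - w⟫ < 0 := by
    by_cases hg : ∃ x ∈ A, ⟪g, x - w⟫ < 0
    · exact ⟨g, hgM, hgf, hg⟩
    · push Not at hg
      refine ⟨-g, neg_mem hgM, by simpa using hgf, ?_⟩
      by_contra! hg'
      obtain ⟨z, hz⟩ := hint
      have h1 := (isInnerNormal_convexHull (A := (A : Set E)) hg).inner_pos hg0 hz
      have h2 := isInnerNormal_convexHull (A := (A : Set E)) hg' z (interior_subset hz)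
      rw [inner_neg_left] at h2
      linarith
  classical
  obtain ⟨x₂, hx₂, hmin⟩ := Finset.exists_min_image (A.filter fun x => ⟪g, x - w⟫ < 0)
    (fun x => ⟪f, x - w⟫ / -⟪g, x - w⟫) ⟨x₁, by simp [hx₁, hgx₁]⟩
  rw [Finset.mem_filter] at hx₂
  obtain ⟨hx₂A, hgx₂⟩ := hx₂
  have hfA : ∀ x ∈ A, 0 ≤ ⟪f, x - w⟫ := fun x hx => hf x (subset_convexHull ℝ _ hx)
  set r := ⟪f, x₂ - w⟫ / -⟪g, x₂ - w⟫ with hr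
  have hr0 : 0 ≤ r := div_nonneg (hfA x₂ hx₂A) (by linarith)
  have hinner : ∀ y, ⟪f + r • g, y⟫ = ⟪f, y⟫ + r * ⟪g, y⟫ := fun y => by
    rw [inner_add_left, real_inner_smul_left]
  have hn : IsInnerNormal P w (f + r • g) := isInnerNormal_convexHull fun x hx => by
    rw [hinner]
    rcases lt_or_ge ⟪g, x - w⟫ 0 with hgx | hgx
    · have := hmin x (by simp [Finset.mem_coe.1 hx, hgx])
      rw [le_div_iff₀ (by linarith)] at this
      linarith
    · have := hfA x hx
      positivity
  have hn0 : f + r • g ≠ 0 := fun h0 => by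
    have h1 : ⟪f, f + r • g⟫ = 0 := by rw [h0, inner_zero_right]
    rw [inner_add_right, real_inner_smul_right, hgf, mul_zero, add_zero] at h1
    exact hf0 (inner_self_eq_zero.1 h1)
  have hle : M ≤ contactSpan A w (f + r • g) := by
    refine Submodule.span_le.2 ?_
    rintro _ ⟨x, hx, h0, rfl⟩
    refine sub_mem_contactSpan hx ?_
    rw [hinner, h0, Submodule.inner_left_of_mem_orthogonal (sub_mem_contactSpan hx h0) hgM]
    simp
  have hx₂M : x₂ - w ∈ contactSpan A w (f + r • g) := by
    refine sub_mem_contactSpan hx₂A ?_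
    rw [hinner, hr, div_neg, neg_mul, div_mul_cancel₀ _ hgx₂.ne, add_neg_cancel]
  have hx₂M' : x₂ - w ∉ M := fun h =>
    hgx₂.ne (Submodule.inner_left_of_mem_orthogonal h hgM)
  exact (hmax' _ hn0 hn).not_gt (Submodule.finrank_lt_finrank_of_lt
    (lt_of_le_of_ne hle fun h => hx₂M' (h ▸ hx₂M)))

end InnerNormals

section Faces

variable {E : Type*} [NormedAddCommGroup E] [InnerProductSpace ℝ E]

theorem IsInnerNormal.isFace {P : Set E} (hconv : Convex ℝ P) {w h : E} (hw : w ∈ P)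
    (hh : IsInnerNormal P w h) : IsFace P {x ∈ P | ⟪h, x - w⟫ = 0} := by
  refine ⟨⟨w, hw, by simp⟩, ?_, fun x hx => hx.1, ?_⟩
  · have hneg := convex_setOf_inner_sub_nonneg w (-h)
    convert! hconv.inter ((convex_setOf_inner_sub_nonneg w h).inter hneg) using 1
    ext x
    simp only [le_antisymm_iff, Set.mem_inter_iff, Set.mem_ofPred_eq, inner_neg_left, neg_nonneg]
    tauto
  · rintro x hx y hy z ⟨-, hz0⟩ ⟨s, t, hs, ht, hst, rfl⟩
    refine ⟨hx, ?_⟩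
    have hcomb : s • x + t • y - w = s • (x - w) + t • (y - w) := by
      have : w = (s + t) • w := by rw [hst, one_smul]
      nth_rewrite 1 [this]
      module
    rw [hcomb, inner_add_right, real_inner_smul_right, real_inner_smul_right] at hz0
    have h1 := hh x hx
    have h2 := hh y hy
    have h3 : s * ⟪h, x - w⟫ = 0 := by nlinarith [mul_nonneg hs.le h1, mul_nonneg ht.le h2]
    exact (mul_eq_zero.1 h3).resolve_left hs.ne'

variable [FiniteDimensional ℝ E]

/-- Every boundary point of a full-dimensional polytope lies in a facet, cut out by an inner
normal. -/
theorem exists_isInnerNormal_faceDim {A : Finset E} {w : E} {d : ℕ}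
    (hd : Module.finrank ℝ E = d + 1) (hint : (interior (convexHull ℝ (A : Set E))).Nonempty)
    (hw : w ∈ frontier (convexHull ℝ (A : Set E))) :
    ∃ f, IsInnerNormal (convexHull ℝ (A : Set E)) w f ∧
      faceDim {x ∈ convexHull ℝ (A : Set E) | ⟪f, x - w⟫ = 0} = d := by
  obtain ⟨f, hf0, hf, hfd⟩ := exists_isInnerNormal_finrank_contactSpan hd hint hw
  refine ⟨f, hf, le_antisymm ?_ ?_⟩
  · have : Fact (Module.finrank ℝ E = d + 1) := ⟨hd⟩
    rw [faceDim, ← Submodule.finrank_orthogonal_span_singleton (𝕜 := ℝ) (n := d) hf0]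
    refine Submodule.finrank_mono ?_
    rw [direction_affineSpan, vectorSpan_def, Submodule.span_le]
    rintro _ ⟨x, ⟨-, hx⟩, y, ⟨-, hy⟩, rfl⟩
    refine Submodule.mem_orthogonal_singleton_iff_inner_right.2 ?_
    change ⟪f, x - y⟫ = 0
    rw [← sub_sub_sub_cancel_right x y w, inner_sub_right, hx, hy, sub_zero]
  · rw [faceDim, ← hfd]
    refine Submodule.finrank_mono ?_
    rw [contactSpan, direction_affineSpan, Submodule.span_le]
    rintro _ ⟨x, hx, hx0, rfl⟩
    have hwP := (A.finite_toSet.isClosed_convexHull ℝ).frontier_subset hw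
    exact vsub_mem_vectorSpan ℝ ⟨subset_convexHull ℝ _ hx, hx0⟩ ⟨hwP, by simp⟩

/-- If every direction of a subspace `N` can be followed inside `P` from a point of the face `F`,
then `F` has dimension at least that of `N`. -/
theorem finrank_le_faceDim {P F : Set E} (hF : IsFace P F) {w : E} (hw : w ∈ F)
    {N : Submodule ℝ E}
    (hN : ∀ ℓ ∈ N, ∃ ε > (0 : ℝ), w + ε • ℓ ∈ P) : Module.finrank ℝ N ≤ faceDim F := by
  refine Submodule.finrank_mono fun ℓ hℓ => ?_
  obtain ⟨ε, hε, hεP⟩ := hN ℓ hℓ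
  obtain ⟨η, hη, hηP⟩ := hN (-ℓ) (neg_mem hℓ)
  have hmem : w ∈ openSegment ℝ (w + ε • ℓ) (w + η • (-ℓ)) := by
    refine ⟨η / (ε + η), ε / (ε + η), by positivity, by positivity, ?_, ?_⟩
    · field_simp
      ring
    · have h1 : η / (ε + η) + ε / (ε + η) = 1 := by
        field_simp
        ring
      have h2 : η / (ε + η) * ε = ε / (ε + η) * η := by ring
      have h3 : (η / (ε + η)) • (w + ε • ℓ) + (ε / (ε + η)) • (w + η • (-ℓ)) =
          (η / (ε + η) + ε / (ε + η)) • w +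
            (η / (ε + η) * ε - ε / (ε + η) * η) • ℓ := by module
      rw [h3, h1, h2, one_smul, sub_self, zero_smul, add_zero]
  have hεF : w + ε • ℓ ∈ F := hF.2.2.left_mem_of_mem_openSegment hεP hηP hw hmem
  have hsub : (w + ε • ℓ) -ᵥ w ∈ vectorSpan ℝ F := vsub_mem_vectorSpan ℝ hεF hw
  rw [vsub_eq_sub, add_sub_cancel_left] at hsub
  rw [direction_affineSpan]
  exact (Submodule.smul_mem_iff _ hε.ne').1 hsub

/-- At a point in a face of codimension at least three, any two vectors have a common orthogonal
direction that is not orthogonal to all inner normals. -/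
theorem exists_isInnerNormal_inner_ne_zero {A : Finset E} {F : Set E} {w : E} {d : ℕ}
    (hd : Module.finrank ℝ E = d + 1) (hF : IsFace (convexHull ℝ (A : Set E)) F)
    (hFd : faceDim F + 2 ≤ d) (hw : w ∈ F) (f g : E) :
    ∃ ℓ h, ⟪f, ℓ⟫ = 0 ∧ ⟪g, ℓ⟫ = 0 ∧ IsInnerNormal (convexHull ℝ (A : Set E)) w h ∧
      ⟪h, ℓ⟫ ≠ 0 := by
  classical
  by_contra! hcon
  set N : Submodule ℝ E := (Submodule.span ℝ (({f, g} : Finset E) : Set E))ᗮ with hN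
  have hNd : d ≤ Module.finrank ℝ N + 1 := by
    have h1 : _ + Module.finrank ℝ N = _ := Submodule.finrank_add_finrank_orthogonal
      (Submodule.span ℝ (({f, g} : Finset E) : Set E))
    have h2 := finrank_span_finset_le_card (R := ℝ) ({f, g} : Finset E)
    rw [Set.finrank] at h2
    have h3 : ({f, g} : Finset E).card ≤ 2 := Finset.card_le_two
    omega
  have hle := finrank_le_faceDim hF hw (N := N) fun ℓ hℓ => by
    rw [hN, Submodule.mem_orthogonal] at hℓ
    exact exists_add_smul_mem_convexHull (hF.2.2.subset hw) fun h hh =>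
      hcon ℓ h (hℓ f (Submodule.subset_span (by simp))) (hℓ g (Submodule.subset_span (by simp))) hh
  omega

end Faces

section Shortcut

variable {E : Type*} [NormedAddCommGroup E] [InnerProductSpace ℝ E]

/-- Let `u`, `v` be nonzero vectors at `w` that are not opposite and have inner normals `f`, `g`
orthogonal to them. If a common orthogonal direction `ℓ` of `f` and `g` is not orthogonal to some
inner normal `h`, then the corner `w` of the broken line from `w + u` to `w + v` can be cut off
outside the interior of `P`. -/
theorem intrinsicDist_lt_of_inner_ne_zero [CompleteSpace E] {P : Set E} (hcl : IsClosed P)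
    (hconv : Convex ℝ P) {w u v f g h ℓ : E} (hu : u ≠ 0) (hv : v ≠ 0)
    (huP : w + u ∈ P) (hvP : w + v ∈ P) (huv : ‖u‖ • v + ‖v‖ • u ≠ 0)
    (hf0 : f ≠ 0) (hf : IsInnerNormal P w f) (hfu : ⟪f, u⟫ = 0)
    (hg0 : g ≠ 0) (hg : IsInnerNormal P w g) (hgv : ⟪g, v⟫ = 0)
    (hh : IsInnerNormal P w h) (hfℓ : ⟪f, ℓ⟫ = 0) (hgℓ : ⟪g, ℓ⟫ = 0) (hhℓ : ⟪h, ℓ⟫ ≠ 0) :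
    intrinsicDist (frontier P) (w + u) (w + v) < ENNReal.ofReal (‖u‖ + ‖v‖) := by
  have hu' : 0 < ‖u‖ := norm_pos_iff.2 hu
  have hv' : 0 < ‖v‖ := norm_pos_iff.2 hv
  -- it suffices to find a first-order shortcut along the three supporting hyperplanes
  have key : ∀ p q k : E, k ≠ 0 → IsInnerNormal P w k → ⟪f, p⟫ = 0 → ⟪g, q⟫ = 0 →
      ⟪k, p⟫ ≤ 0 → ⟪k, q⟫ ≤ 0 → ‖p - q‖ < ⟪u, p⟫ / ‖u‖ + ⟪v, q⟫ / ‖v‖ →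
      intrinsicDist (frontier P) (w + u) (w + v) < ENNReal.ofReal (‖u‖ + ‖v‖) := by
    intro p q k hk0 hk hfp hgq hkp hkq hlt
    obtain ⟨c, hc, hcl'⟩ := exists_shorter_polyline hu hv hlt
    have hlen := intrinsicDist_frontier_le_of_polyline hcl hconv (a := w + u) (b := w + v)
      (p := w + c • p) (q := w + c • q) huP hvP
      (hf.disjoint_segment_interior hf0 (by simp [hfu])
        (by simp [real_inner_smul_right, hfp]))
      (hk.disjoint_segment_interior hk0
        (by simpa [real_inner_smul_right] using mul_nonpos_of_nonneg_of_nonpos hc.le hkp)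
        (by simpa [real_inner_smul_right] using mul_nonpos_of_nonneg_of_nonpos hc.le hkq))
      (hg.disjoint_segment_interior hg0 (by simp [real_inner_smul_right, hgq])
        (by simp [hgv]))
    simp only [add_sub_add_left_eq_sub] at hlen
    exact hlen.trans_lt ((ENNReal.ofReal_lt_ofReal_iff (by positivity)).2 hcl')
  set D := ⟪u, ℓ⟫ / ‖u‖ + ⟪v, ℓ⟫ / ‖v‖ with hD
  rcases lt_trichotomy D 0 with hD0 | hD0 | hD0
  · refine key (-ℓ) (-ℓ) f hf0 hf ?_ ?_ ?_ ?_ ?_ <;> simp [hfℓ, hgℓ, neg_div]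
    linarith
  · -- the two unfolded segments are aligned, so the corner is cut off by the normal `h` instead
    obtain ⟨m, hfm, hgm, hhm, hDm⟩ : ∃ m, ⟪f, m⟫ = 0 ∧ ⟪g, m⟫ = 0 ∧ ⟪h, m⟫ < 0 ∧
        ⟪u, m⟫ / ‖u‖ + ⟪v, m⟫ / ‖v‖ = 0 := by
      rcases hhℓ.lt_or_gt with hneg | hpos
      · exact ⟨ℓ, hfℓ, hgℓ, hneg, hD0⟩
      · refine ⟨-ℓ, by simpa, by simpa, by simpa, ?_⟩
        rw [inner_neg_right, inner_neg_right, neg_div, neg_div]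
        linarith
    have hh0 : h ≠ 0 := by
      rintro rfl
      simp at hhm
    obtain ⟨α, hα, hαu, hαv⟩ : ∃ α > (0 : ℝ), ⟪h, m⟫ + α * (⟪h, u⟫ / ‖u‖) ≤ 0 ∧
        ⟪h, m⟫ + α * (⟪h, v⟫ / ‖v‖) ≤ 0 := by
      have hsmall : ∀ x : ℝ, ∀ᶠ α in nhdsWithin (0 : ℝ) (Set.Ioi 0), ⟪h, m⟫ + α * x ≤ 0 := by
        intro x
        have hc : Continuous fun α : ℝ => ⟪h, m⟫ + α * x := by fun_prop
        have ht := (hc.tendsto 0).mono_left (nhdsWithin_le_nhds (s := Set.Ioi 0))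
        simp only [zero_mul, add_zero] at ht
        filter_upwards [ht.eventually_lt_const hhm] with α hα using hα.le
      obtain ⟨α, ⟨h1, h2⟩, h3⟩ := (((hsmall (⟪h, u⟫ / ‖u‖)).and
        (hsmall (⟪h, v⟫ / ‖v‖))).and self_mem_nhdsWithin).exists
      exact ⟨α, h3, h1, h2⟩
    refine key (m + (α / ‖u‖) • u) (m + (α / ‖v‖) • v) h hh0 hh ?_ ?_ ?_ ?_ ?_
    · rw [inner_add_right, real_inner_smul_right, hfm, hfu, mul_zero, add_zero]
    · rw [inner_add_right, real_inner_smul_right, hgm, hgv, mul_zero, add_zero]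
    · rw [inner_add_right, real_inner_smul_right, div_mul_eq_mul_div, mul_div_assoc]
      exact hαu
    · rw [inner_add_right, real_inner_smul_right, div_mul_eq_mul_div, mul_div_assoc]
      exact hαv
    · have hrhs : ⟪u, m + (α / ‖u‖) • u⟫ / ‖u‖ + ⟪v, m + (α / ‖v‖) • v⟫ / ‖v‖ = α + α := by
        rw [inner_add_right, inner_add_right, real_inner_smul_right, real_inner_smul_right,
          real_inner_self_eq_norm_sq, real_inner_self_eq_norm_sq, add_div, add_div]
        have h1 : α / ‖u‖ * ‖u‖ ^ 2 / ‖u‖ = α := by field_simp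
        have h2 : α / ‖v‖ * ‖v‖ ^ 2 / ‖v‖ = α := by field_simp
        rw [h1, h2]
        linarith
      rw [hrhs, add_sub_add_left_eq_sub]
      have hnu : ‖(α / ‖u‖) • u‖ = α := by
        rw [norm_smul, Real.norm_eq_abs, abs_of_pos (by positivity), div_mul_cancel₀ _ hu'.ne']
      have hnv : ‖(α / ‖v‖) • v‖ = α := by
        rw [norm_smul, Real.norm_eq_abs, abs_of_pos (by positivity), div_mul_cancel₀ _ hv'.ne']
      have hle := norm_sub_le ((α / ‖u‖) • u) ((α / ‖v‖) • v)
      rw [hnu, hnv] at hle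
      refine lt_of_le_of_ne hle fun heq => huv ?_
      have hpar := parallelogram_law_with_norm ℝ ((α / ‖u‖) • u) ((α / ‖v‖) • v)
      rw [heq, hnu, hnv] at hpar
      have hsum : ‖(α / ‖u‖) • u + (α / ‖v‖) • v‖ = 0 := by
        have : ‖(α / ‖u‖) • u + (α / ‖v‖) • v‖ * ‖(α / ‖u‖) • u + (α / ‖v‖) • v‖ = 0 := by
          linarith
        exact mul_self_eq_zero.1 this
      have hsmul : ‖u‖ • v + ‖v‖ • u =
          (‖u‖ * ‖v‖ / α) • ((α / ‖u‖) • u + (α / ‖v‖) • v) := by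
        rw [smul_add, smul_smul, smul_smul, add_comm]
        congr 2 <;> field_simp
      rw [hsmul, norm_eq_zero.1 hsum, smul_zero]
  · refine key ℓ ℓ f hf0 hf hfℓ hgℓ hfℓ.le hfℓ.le ?_
    simpa using hD0

end Shortcut

/-- Lemma 1.2: let `w` be a warped point of the boundary `S = frontier P`
(lying in a face of dimension at most `d - 2`), and let `[a₀, w] ⊆ S` and
`[w, b₀] ⊆ S` be nondegenerate straight segments not both contained in a common
facet. Then for all `a ∈ [a₀, w]` and `b ∈ [w, b₀]` sufficiently close to (but
distinct from) `w`, the intrinsic distance satisfies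
`μ(a, b) < ‖a - w‖ + ‖w - b‖`, so the path from `a` through `w` to `b` along
the two segments is not a shortest path in `S`. -/
theorem path_through_warped_point_not_shortest {d : ℕ} (hd : 1 ≤ d)
    (P : Set (EuclideanSpace ℝ (Fin (d + 1))))
    (hP : ∃ A : Finset (EuclideanSpace ℝ (Fin (d + 1))),
      P = convexHull ℝ (A : Set (EuclideanSpace ℝ (Fin (d + 1)))))
    (hint : (interior P).Nonempty)
    (w a₀ b₀ : EuclideanSpace ℝ (Fin (d + 1)))
    (hw : ∃ F : Set (EuclideanSpace ℝ (Fin (d + 1))),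
      IsFace P F ∧ faceDim F + 2 ≤ d ∧ w ∈ F)
    (ha₀ : a₀ ≠ w) (hb₀ : b₀ ≠ w)
    (hseg1 : segment ℝ a₀ w ⊆ frontier P)
    (hseg2 : segment ℝ w b₀ ⊆ frontier P)
    (hnofacet : ∀ F : Set (EuclideanSpace ℝ (Fin (d + 1))),
      IsFace P F → faceDim F = d →
        ¬(segment ℝ a₀ w ⊆ F ∧ segment ℝ w b₀ ⊆ F)) :
    ∃ δ > 0, ∀ a ∈ segment ℝ a₀ w, ∀ b ∈ segment ℝ w b₀,
      0 < ‖a - w‖ → ‖a - w‖ < δ → 0 < ‖b - w‖ → ‖b - w‖ < δ →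
        intrinsicDist (frontier P) a b < ENNReal.ofReal (‖a - w‖ + ‖w - b‖) := by
  obtain ⟨A, rfl⟩ := hP
  obtain ⟨F, hF, hFd, hwF⟩ := hw
  have hdim : Module.finrank ℝ (EuclideanSpace ℝ (Fin (d + 1))) = d + 1 := by simp
  have hconv := convex_convexHull ℝ (A : Set (EuclideanSpace ℝ (Fin (d + 1))))
  have hcl := A.finite_toSet.isClosed_convexHull ℝ
  have hseg2' : segment ℝ b₀ w ⊆ frontier (convexHull ℝ (A : Set _)) :=
    segment_symm ℝ w b₀ ▸ hseg2
  obtain ⟨f, hf0, hf, hfa⟩ :=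
    exists_isInnerNormal_of_segment_subset_frontier hconv hcl hint hseg1
  obtain ⟨g, hg0, hg, hgb⟩ :=
    exists_isInnerNormal_of_segment_subset_frontier hconv hcl hint hseg2'
  obtain ⟨ℓ, h, hfℓ, hgℓ, hh, hhℓ⟩ :=
    exists_isInnerNormal_inner_ne_zero hdim hF hFd hwF f g
  refine ⟨1, one_pos, fun a ha b hb haw _ hbw _ => ?_⟩
  have haP := hcl.frontier_subset (hseg1 ha)
  have hbP := hcl.frontier_subset (hseg2 hb)
  have hwfr := hseg1 (right_mem_segment ℝ a₀ w)
  have hwP := hcl.frontier_subset hwfr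
  obtain ⟨s, hs, hsa⟩ : ∃ s : ℝ, 0 ≤ s ∧ a - w = s • (a₀ - w) := by
    obtain ⟨s, t, hs, -, hst, rfl⟩ := ha
    refine ⟨s, hs, ?_⟩
    rw [← eq_sub_iff_add_eq'] at hst
    rw [hst]
    module
  obtain ⟨t, ht, htb⟩ : ∃ t : ℝ, 0 ≤ t ∧ b - w = t • (b₀ - w) := by
    obtain ⟨s, t, -, ht, hst, rfl⟩ := hb
    refine ⟨t, ht, ?_⟩
    rw [← eq_sub_iff_add_eq] at hst
    rw [hst]
    module
  have hs0 : s ≠ 0 := by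
    rintro rfl
    simp [hsa] at haw
  have ht0 : t ≠ 0 := by
    rintro rfl
    simp [htb] at hbw
  have hopp : ‖a - w‖ • (b - w) + ‖b - w‖ • (a - w) ≠ 0 := by
    intro hzero
    -- opposite segments at `w` lie in every facet through `w`
    obtain ⟨k, hk, hkd⟩ := exists_isInnerNormal_faceDim hdim hint hwfr
    have hface := hk.isFace hconv hwP
    have hk1 := hk a haP
    have hk2 := hk b hbP
    have hk3 := congrArg (fun y => ⟪k, y⟫) hzero
    simp only [inner_add_right, real_inner_smul_right, inner_zero_right] at hk3
    have hka : ⟪k, a - w⟫ = 0 := by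
      refine (mul_eq_zero.1 (?_ : ‖b - w‖ * ⟪k, a - w⟫ = 0)).resolve_left hbw.ne'
      linarith [mul_nonneg haw.le hk2, mul_nonneg hbw.le hk1]
    have hkb : ⟪k, b - w⟫ = 0 := by
      refine (mul_eq_zero.1 (?_ : ‖a - w‖ * ⟪k, b - w⟫ = 0)).resolve_left haw.ne'
      linarith [mul_nonneg haw.le hk2, mul_nonneg hbw.le hk1]
    rw [hsa, real_inner_smul_right] at hka
    rw [htb, real_inner_smul_right] at hkb
    have hwF' : w ∈ {x ∈ convexHull ℝ (A : Set _) | ⟪k, x - w⟫ = 0} := ⟨hwP, by simp⟩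
    exact hnofacet _ hface hkd
      ⟨hface.2.1.segment_subset ⟨hcl.frontier_subset (hseg1 (left_mem_segment ℝ a₀ w)),
          (mul_eq_zero.1 hka).resolve_left hs0⟩ hwF',
        hface.2.1.segment_subset hwF' ⟨hcl.frontier_subset (hseg2 (right_mem_segment ℝ w b₀)),
          (mul_eq_zero.1 hkb).resolve_left ht0⟩⟩
  have hmain := intrinsicDist_lt_of_inner_ne_zero hcl hconv (w := w) (u := a - w) (v := b - w)
    (norm_pos_iff.1 haw) (norm_pos_iff.1 hbw) (by simpa using haP) (by simpa using hbP) hopp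
    hf0 hf (by rw [hsa, real_inner_smul_right, hfa, mul_zero])
    hg0 hg (by rw [htb, real_inner_smul_right, hgb, mul_zero]) hh hfℓ hgℓ hhℓ
  rw [add_sub_cancel, add_sub_cancel] at hmain
  rwa [norm_sub_rev w b]
end

section
/- Fix d ≥ 1, let P ⊆ EuclideanSpace ℝ (Fin (d+1)) be a convex polytope with nonempty interior, let S = frontier P, and let v ∈ S be a source point lying in the relative interior of a face of P of dimension d. Let γ be a shortest path in S from v to a point w ∈ S, and let c = γ(t₀) for some t₀ ∈ (0,1) with c ∉ {v, w}. Then any two shortest paths in S from v to c have the same image; that is, no shortest path in S to the source point v has a cut point in its relative interior. (Corollary 2.2 of the paper.) -/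
open scoped RealInnerProductSpace ENNReal

section IntrinsicDist

variable {E : Type*} [NormedAddCommGroup E] [InnerProductSpace ℝ E]

theorem intrinsicDist_le_eVariationOn {S : Set E} {γ : ℝ → E} {s t : ℝ} (hst : s ≤ t)
    (hγ : ContinuousOn γ (Set.Icc s t)) (hS : Set.MapsTo γ (Set.Icc s t) S) :
    intrinsicDist S (γ s) (γ t) ≤ eVariationOn γ (Set.Icc s t) := by
  have hφ : Set.MapsTo (fun u : ℝ => s + u * (t - s)) (Set.Icc 0 1) (Set.Icc s t) := by
    rintro u ⟨h0, h1⟩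
    constructor <;> nlinarith
  have hmono : Monotone (fun u : ℝ => s + u * (t - s)) := by
    intro u u' h
    have : u * (t - s) ≤ u' * (t - s) := mul_le_mul_of_nonneg_right h (by linarith)
    simpa using this
  have hpath : IsPathIn S (γ s) (γ t) (γ ∘ fun u : ℝ => s + u * (t - s)) :=
    ⟨hγ.comp (by fun_prop) hφ, by simp, by simp, hS.comp hφ⟩
  exact (iInf₂_le _ hpath).trans
    (eVariationOn.comp_le_of_monotoneOn γ _ (hmono.monotoneOn _) hφ)

theorem edist_le_intrinsicDist (S : Set E) (a b : E) : edist a b ≤ intrinsicDist S a b := by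
  refine le_iInf₂ fun γ hγ => ?_
  have := eVariationOn.edist_le γ (s := Set.Icc (0 : ℝ) 1) (x := 0) (y := 1) (by simp) (by simp)
  rwa [hγ.2.1, hγ.2.2.1] at this

theorem IsShortestPath.eVariationOn_eq {S : Set E} {a b : E} {γ : ℝ → E}
    (hγ : IsShortestPath S a b γ) (hab : intrinsicDist S a b ≠ ⊤) {s t : ℝ} (hs : 0 ≤ s)
    (hst : s ≤ t) (ht : t ≤ 1) :
    eVariationOn γ (Set.Icc s t) = intrinsicDist S (γ s) (γ t) := by
  obtain ⟨⟨hc, h0, h1, hS⟩, hlen⟩ := hγ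
  have sub : ∀ {p q : ℝ}, 0 ≤ p → p ≤ q → q ≤ 1 →
      intrinsicDist S (γ p) (γ q) ≤ eVariationOn γ (Set.Icc p q) := by
    intro p q hp hpq hq
    have := Set.Icc_subset_Icc hp hq
    exact intrinsicDist_le_eVariationOn hpq (hc.mono this) (hS.mono_left this)
  have e1 := eVariationOn.Icc_add_Icc γ (s := Set.univ) hs hst (Set.mem_univ _)
  have e2 := eVariationOn.Icc_add_Icc γ (s := Set.univ) (hs.trans hst) ht (Set.mem_univ _)
  simp only [Set.univ_inter] at e1 e2
  rw [pathLength, ← e2, ← e1] at hlen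
  have hA := sub le_rfl hs (hst.trans ht)
  have hC := sub (hs.trans hst) ht le_rfl
  rw [h0] at hA
  rw [h1] at hC
  have hfin : eVariationOn γ (Set.Icc 0 s) + eVariationOn γ (Set.Icc s t)
      + eVariationOn γ (Set.Icc t 1) ≠ ⊤ := hlen ▸ hab
  have hA' : eVariationOn γ (Set.Icc 0 s) ≠ ⊤ := by
    intro h
    simp [h] at hfin
  have hC' : eVariationOn γ (Set.Icc t 1) ≠ ⊤ := by
    intro h
    simp [h] at hfin
  refine le_antisymm ?_ (sub hs hst ht)
  have h : eVariationOn γ (Set.Icc 0 s) + eVariationOn γ (Set.Icc s t)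
      + eVariationOn γ (Set.Icc t 1) ≤ eVariationOn γ (Set.Icc 0 s)
        + intrinsicDist S (γ s) (γ t) + eVariationOn γ (Set.Icc t 1) := by
    rw [hlen]
    refine (intrinsicDist_triangle S a (γ t) b).trans (add_le_add ?_ hC)
    exact (intrinsicDist_triangle S a (γ s) (γ t)).trans (add_le_add hA le_rfl)
  rw [ENNReal.add_le_add_iff_right hC'] at h
  exact (ENNReal.add_le_add_iff_left hA').1 h

theorem IsShortestPath.intrinsicDist_add {S : Set E} {a b : E} {γ : ℝ → E}
    (hγ : IsShortestPath S a b γ) (hab : intrinsicDist S a b ≠ ⊤) {r s t : ℝ} (hr : 0 ≤ r)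
    (hrs : r ≤ s) (hst : s ≤ t) (ht : t ≤ 1) :
    intrinsicDist S (γ r) (γ s) + intrinsicDist S (γ s) (γ t) = intrinsicDist S (γ r) (γ t) := by
  rw [← hγ.eVariationOn_eq hab hr hrs (hst.trans ht),
    ← hγ.eVariationOn_eq hab (hr.trans hrs) hst ht,
    ← hγ.eVariationOn_eq hab hr (hrs.trans hst) ht]
  simpa only [Set.univ_inter] using
    eVariationOn.Icc_add_Icc γ (s := Set.univ) hrs hst (Set.mem_univ _)

theorem IsShortestPath.mem_segment_of_intrinsicDist_eq {S : Set E} {a b : E} {γ : ℝ → E}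
    (hγ : IsShortestPath S a b γ) (hab : intrinsicDist S a b ≠ ⊤) {r s t : ℝ} (hr : 0 ≤ r)
    (hrs : r ≤ s) (hst : s ≤ t) (ht : t ≤ 1)
    (h : intrinsicDist S (γ r) (γ t) = edist (γ r) (γ t)) :
    γ s ∈ segment ℝ (γ r) (γ t) := by
  have h1 : edist (γ r) (γ s) + edist (γ s) (γ t) ≤ edist (γ r) (γ t) := by
    rw [← h, ← hγ.intrinsicDist_add hab hr hrs hst ht]
    exact add_le_add (edist_le_intrinsicDist _ _ _) (edist_le_intrinsicDist _ _ _)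
  rw [edist_dist, edist_dist, edist_dist, ← ENNReal.ofReal_add dist_nonneg dist_nonneg,
    ENNReal.ofReal_le_ofReal_iff dist_nonneg] at h1
  rw [mem_segment_iff_wbtw, ← dist_add_dist_eq_iff]
  exact le_antisymm h1 (dist_triangle _ _ _)

theorem IsShortestPath.segment_subset_image {S : Set E} {a b : E} {γ : ℝ → E}
    (hγ : IsShortestPath S a b γ) (hab : intrinsicDist S a b ≠ ⊤) {s t : ℝ} (hs : 0 ≤ s)
    (hst : s ≤ t) (ht : t ≤ 1) (h : intrinsicDist S (γ s) (γ t) = edist (γ s) (γ t)) :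
    segment ℝ (γ s) (γ t) ⊆ γ '' Set.Icc 0 1 := by
  have hsub := Set.Icc_subset_Icc hs ht
  intro y hy
  have hcont : ContinuousOn (fun r => dist (γ s) (γ r)) (Set.Icc s t) :=
    (by fun_prop : Continuous fun z => dist (γ s) z).comp_continuousOn (hγ.1.1.mono hsub)
  have hyd := dist_add_dist_of_mem_segment hy
  obtain ⟨r, hr, hry⟩ := intermediate_value_Icc hst hcont
    (show dist (γ s) y ∈ _ from ⟨by simp, by linarith [dist_nonneg (x := y) (y := γ t)]⟩)
  refine ⟨r, hsub hr, ?_⟩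
  have hmem := hγ.mem_segment_of_intrinsicDist_eq hab hs hr.1 hr.2 ht h
  rw [segment_eq_image_lineMap] at hy hmem
  obtain ⟨θ, hθ, rfl⟩ := hy
  obtain ⟨η, hη, hη'⟩ := hmem
  simp only at hry
  rw [← hη', dist_left_lineMap, dist_left_lineMap, Real.norm_of_nonneg hη.1,
    Real.norm_of_nonneg hθ.1] at hry
  rw [← hη']
  rcases mul_eq_mul_right_iff.1 hry with h | h
  · rw [h]
  · rw [dist_eq_zero] at h
    simp [h]

end IntrinsicDist

section Supporting

variable {E : Type*} [NormedAddCommGroup E] [InnerProductSpace ℝ E]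

theorem exists_lipschitz_retraction_onto_frontier [CompleteSpace E] {P : Set E}
    (hne : P.Nonempty) (hcl : IsClosed P) (hconv : Convex ℝ P) :
    ∃ π : E → E, LipschitzWith 1 π ∧ (∀ x ∈ P, π x = x) ∧ ∀ x ∉ interior P, π x ∈ frontier P := by
  choose π hπ hmin using fun x => exists_norm_eq_iInf_of_complete_convex hne hcl.isComplete hconv x
  have hin : ∀ x, ∀ y ∈ P, ⟪x - π x, y - π x⟫ ≤ 0 := fun x =>
    (norm_eq_iInf_iff_real_inner_le_zero hconv (hπ x)).1 (hmin x)
  have hfix : ∀ x ∈ P, π x = x := by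
    intro x hx
    have := hin x x hx
    rw [real_inner_self_nonpos, sub_eq_zero] at this
    exact this.symm
  refine ⟨π, LipschitzWith.of_dist_le_mul fun x y => ?_, hfix, fun x hx => ?_⟩
  · have h1 := hin x (π y) (hπ y)
    have h2 := hin y (π x) (hπ x)
    have h3 : ‖π x - π y‖ * ‖π x - π y‖ ≤ ⟪x - y, π x - π y⟫ := by
      rw [← real_inner_self_eq_norm_mul_norm]
      simp only [inner_sub_left, inner_sub_right] at h1 h2 ⊢
      linarith [real_inner_comm (π x) (π y)]
    have h4 := real_inner_le_norm (x - y) (π x - π y)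
    rw [dist_eq_norm, dist_eq_norm, NNReal.coe_one, one_mul]
    by_contra! hlt
    nlinarith [norm_nonneg (x - y)]
  · rw [hcl.frontier_eq]
    refine ⟨hπ x, fun hi => ?_⟩
    by_cases hxP : x ∈ P
    · exact hx (hfix x hxP ▸ hi)
    · have htend : Filter.Tendsto (fun ε : ℝ => π x + ε • (x - π x)) (nhdsWithin 0 (Set.Ioi 0))
          (nhds (π x)) := by
        refine Filter.Tendsto.mono_left ?_ nhdsWithin_le_nhds
        exact Continuous.tendsto' (by fun_prop) _ _ (by simp)
      obtain ⟨ε, hε, hpos⟩ := ((htend.eventually (mem_interior_iff_mem_nhds.1 hi)).and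
        self_mem_nhdsWithin).exists
      have := hin x _ hε
      rw [add_sub_cancel_left, real_inner_smul_right] at this
      have h5 : ⟪x - π x, x - π x⟫ ≤ 0 := by
        by_contra! h
        exact absurd this (not_le.2 (mul_pos hpos h))
      rw [real_inner_self_nonpos, sub_eq_zero] at h5
      exact hxP (h5 ▸ hπ x)

theorem intrinsicDist_frontier_le_edist {P : Set E} {π : E → E} (hlip : LipschitzWith 1 π)
    (hfr : ∀ x ∉ interior P, π x ∈ frontier P) {a b : E}
    (hab : ∀ z ∈ segment ℝ a b, z ∉ interior P) :
    intrinsicDist (frontier P) (π a) (π b) ≤ edist a b := by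
  have hl : LipschitzWith (nndist a b) (π ∘ (AffineMap.lineMap a b : ℝ → E)) := by
    simpa using hlip.comp (lipschitzWith_lineMap a b)
  have h := intrinsicDist_le_eVariationOn (S := frontier P) zero_le_one hl.continuous.continuousOn
    (fun t ht => hfr _ (hab _ (by rw [segment_eq_image_lineMap]; exact ⟨t, ht, rfl⟩)))
  have h2 : eVariationOn (π ∘ (AffineMap.lineMap a b : ℝ → E)) (Set.Icc 0 1) ≤ edist a b := by
    have h3 := (hl.lipschitzOnWith (s := Set.univ)).comp_eVariationOn_le (g := (id : ℝ → ℝ))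
      (Set.mapsTo_univ _ (Set.Icc 0 1))
    have h4 := (monotone_id.monotoneOn (Set.Icc (0 : ℝ) 1)).eVariationOn_eq (a := 0) (b := 1)
      (by simp) (by simp)
    rw [Set.inter_self] at h4
    rw [show eVariationOn (id : ℝ → ℝ) (Set.Icc 0 1) = 1 by simp [h4], mul_one,
      ← edist_nndist] at h3
    exact h3
  simpa using h.trans h2

/-- The half-space `{y | ⟪n, y⟫ ≤ b}`, with unit outward normal `n`, contains `P`. -/
def IsContainingHalfspace (P : Set E) (n : E) (b : ℝ) : Prop :=
  ‖n‖ = 1 ∧ ∀ y ∈ P, ⟪n, y⟫ ≤ b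

theorem IsContainingHalfspace.inner_lt_of_mem_interior {P : Set E} {n : E} {b : ℝ}
    (h : IsContainingHalfspace P n b) {y : E} (hy : y ∈ interior P) : ⟪n, y⟫ < b := by
  have htend : Filter.Tendsto (fun ε : ℝ => y + ε • n) (nhdsWithin 0 (Set.Ioi 0)) (nhds y) := by
    refine Filter.Tendsto.mono_left ?_ nhdsWithin_le_nhds
    exact Continuous.tendsto' (by fun_prop) _ _ (by simp)
  obtain ⟨ε, hε, hpos⟩ := ((htend.eventually (mem_interior_iff_mem_nhds.1 hy)).and
    self_mem_nhdsWithin).exists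
  have := h.2 _ hε
  rw [inner_add_right, real_inner_smul_right, real_inner_self_eq_norm_sq, h.1] at this
  have : 0 < ε := hpos
  linarith

theorem IsContainingHalfspace.ne_neg {P : Set E} {n n' x : E} {b b' : ℝ}
    (h : IsContainingHalfspace P n b) (h' : IsContainingHalfspace P n' b')
    (hint : (interior P).Nonempty) (hx : ⟪n, x⟫ = b) (hx' : ⟪n', x⟫ = b') : n ≠ -n' := by
  rintro rfl
  obtain ⟨y, hy⟩ := hint
  have h1 := h.inner_lt_of_mem_interior hy
  have h2 := h'.inner_lt_of_mem_interior hy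
  rw [inner_neg_left] at h1 hx
  linarith

theorem IsContainingHalfspace.segment_disjoint_interior {P : Set E} {n p q : E} {b : ℝ}
    (h : IsContainingHalfspace P n b) (hp : b ≤ ⟪n, p⟫) (hq : b ≤ ⟪n, q⟫) :
    ∀ z ∈ segment ℝ p q, z ∉ interior P := by
  rintro z ⟨s, t, hs, ht, hst, rfl⟩ hz
  have := h.inner_lt_of_mem_interior hz
  rw [inner_add_right, real_inner_smul_right, real_inner_smul_right] at this
  have h1 := mul_le_mul_of_nonneg_left hp hs
  have h2 := mul_le_mul_of_nonneg_left hq ht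
  have h3 : s * b + t * b = b := by rw [← add_mul, hst, one_mul]
  linarith

theorem exists_isContainingHalfspace [CompleteSpace E] {P : Set E} (hconv : Convex ℝ P)
    (hint : (interior P).Nonempty) {x : E} (hx : x ∈ frontier P) :
    ∃ n, IsContainingHalfspace P n ⟪n, x⟫ := by
  obtain ⟨f, hf, hle⟩ := geometric_hahn_banach_of_nonempty_interior_point hconv hx.2 hint
  set m := (InnerProductSpace.toDual ℝ E).symm f with hm
  have hm0 : m ≠ 0 := by simpa [hm] using hf
  have hfm : ∀ y, f y = ⟪m, y⟫ := fun y => by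
    rw [hm, InnerProductSpace.toDual_symm_apply]
  refine ⟨‖m‖⁻¹ • m, by
    rw [norm_smul, norm_inv, norm_norm, inv_mul_cancel₀ (norm_ne_zero_iff.2 hm0)], fun y hy => ?_⟩
  rw [real_inner_smul_left, real_inner_smul_left, ← hfm, ← hfm]
  exact mul_le_mul_of_nonneg_left (hle y hy) (by positivity)

theorem exists_finite_isContainingHalfspace [CompleteSpace E] {A : Finset E}
    (hint : (interior (convexHull ℝ (A : Set E))).Nonempty) :
    ∃ T : Set (E × ℝ), T.Finite ∧
      (∀ p ∈ T, IsContainingHalfspace (convexHull ℝ (A : Set E)) p.1 p.2) ∧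
      ∀ x ∈ frontier (convexHull ℝ (A : Set E)), ∃ p ∈ T, ⟪p.1, x⟫ = p.2 := by
  classical
  set P := convexHull ℝ (A : Set E) with hP
  have hcl : IsClosed P := A.finite_toSet.isClosed_convexHull ℝ
  let good : Finset E → E × ℝ → Prop := fun B p =>
    IsContainingHalfspace P p.1 p.2 ∧ ∀ a ∈ B, ⟪p.1, a⟫ = p.2
  let rep : Finset E → Set (E × ℝ) := fun B => {p | ∃ h : ∃ q, good B q, p = h.choose}
  refine ⟨⋃ B ∈ A.powerset, rep B, ?_, ?_, ?_⟩
  · refine Set.Finite.biUnion A.powerset.finite_toSet fun B _ => Set.Subsingleton.finite ?_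
    rintro p ⟨_, rfl⟩ q ⟨_, rfl⟩
    rfl
  · intro p hp
    simp only [Set.mem_iUnion] at hp
    obtain ⟨B, _, h, rfl⟩ := hp
    exact h.choose_spec.1
  · intro x hx
    obtain ⟨n, hn⟩ := exists_isContainingHalfspace (convex_convexHull ℝ _) hint hx
    set B := A.filter fun a => ⟪n, a⟫ = ⟪n, x⟫ with hB
    have hex : ∃ q, good B q := ⟨(n, ⟪n, x⟫), hn, fun a ha => (Finset.mem_filter.1 ha).2⟩
    refine ⟨hex.choose, Set.mem_biUnion (Finset.mem_powerset.2 (Finset.filter_subset _ _))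
      ⟨hex, rfl⟩, ?_⟩
    obtain ⟨_, hq⟩ := hex.choose_spec
    obtain ⟨w, hw0, hw1, hwx⟩ := (Finset.mem_convexHull).1 (hcl.frontier_subset hx)
    rw [Finset.centerMass_eq_of_sum_1 _ _ hw1] at hwx
    simp only [id] at hwx
    have hlin : ∀ m : E, ⟪m, x⟫ = ∑ a ∈ A, w a * ⟪m, a⟫ := by
      intro m
      rw [← hwx, inner_sum]
      simp only [real_inner_smul_right]
    have hzero : ∑ a ∈ A, w a * (⟪n, x⟫ - ⟪n, a⟫) = 0 := by
      simp only [mul_sub, Finset.sum_sub_distrib, ← Finset.sum_mul, hw1, ← hlin]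
      ring
    have hterm := (Finset.sum_eq_zero_iff_of_nonneg fun a ha => mul_nonneg (hw0 a ha)
      (sub_nonneg.2 (hn.2 a (subset_convexHull ℝ _ ha)))).1 hzero
    have hqa : ∀ a ∈ A, w a * ⟪hex.choose.1, a⟫ = w a * hex.choose.2 := by
      intro a ha
      rcases mul_eq_zero.1 (hterm a ha) with h | h
      · simp [h]
      · rw [hq a (Finset.mem_filter.2 ⟨ha, by linarith⟩)]
    rw [hlin, Finset.sum_congr rfl hqa, ← Finset.sum_mul, hw1, one_mul]

theorem intrinsicDist_frontier_eq_edist [CompleteSpace E] {P : Set E} (hcl : IsClosed P)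
    (hconv : Convex ℝ P) {n p q : E} {b : ℝ} (h : IsContainingHalfspace P n b) (hp : p ∈ P)
    (hq : q ∈ P) (hpb : ⟪n, p⟫ = b) (hqb : ⟪n, q⟫ = b) :
    intrinsicDist (frontier P) p q = edist p q := by
  obtain ⟨π, hlip, hfix, hfr⟩ := exists_lipschitz_retraction_onto_frontier ⟨p, hp⟩ hcl hconv
  refine le_antisymm ?_ (edist_le_intrinsicDist _ _ _)
  simpa only [hfix p hp, hfix q hq] using intrinsicDist_frontier_le_edist hlip hfr
    (h.segment_disjoint_interior hpb.ge hqb.ge)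

theorem intrinsicDist_frontier_le_edist_add_edist [CompleteSpace E] {P : Set E}
    (hcl : IsClosed P) (hconv : Convex ℝ P) {n n' p q z : E} {b b' : ℝ}
    (h : IsContainingHalfspace P n b) (h' : IsContainingHalfspace P n' b') (hp : p ∈ P)
    (hq : q ∈ P) (hpb : ⟪n, p⟫ = b) (hqb : ⟪n', q⟫ = b') (hz : ⟪n, z⟫ = b) (hz' : ⟪n', z⟫ = b') :
    intrinsicDist (frontier P) p q ≤ edist p z + edist z q := by
  obtain ⟨π, hlip, hfix, hfr⟩ := exists_lipschitz_retraction_onto_frontier ⟨p, hp⟩ hcl hconv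
  have h1 := intrinsicDist_frontier_le_edist hlip hfr
    (h.segment_disjoint_interior hpb.ge hz.ge)
  have h2 := intrinsicDist_frontier_le_edist hlip hfr
    (h'.segment_disjoint_interior hz'.ge hqb.ge)
  rw [hfix p hp] at h1
  rw [hfix q hq] at h2
  exact (intrinsicDist_triangle _ _ _ _).trans (add_le_add h1 h2)

theorem exists_ne_zero_inner_nonneg [FiniteDimensional ℝ E] (hdim : 2 ≤ Module.finrank ℝ E)
    {m n : E} (hm : ‖m‖ = 1) (hn : ‖n‖ = 1) : ∃ e : E, e ≠ 0 ∧ 0 ≤ ⟪m, e⟫ ∧ 0 ≤ ⟪n, e⟫ := by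
  by_cases hmn : m + n = 0
  · obtain ⟨e, he, he0⟩ := Submodule.exists_mem_ne_zero_of_ne_bot
      (p := (ℝ ∙ m)ᗮ) (by
        intro hbot
        have h1 := Submodule.finrank_add_finrank_orthogonal (ℝ ∙ m)
        have h2 := finrank_span_singleton (K := ℝ) (v := m) (by rintro rfl; simp at hm)
        rw [hbot, finrank_bot] at h1
        omega)
    rw [Submodule.mem_orthogonal_singleton_iff_inner_right] at he
    refine ⟨e, he0, he.ge, ?_⟩
    rw [eq_neg_of_add_eq_zero_right hmn, inner_neg_left, he, neg_zero]
  · have h := neg_le_of_abs_le (abs_real_inner_le_norm m n)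
    rw [hm, hn] at h
    refine ⟨m + n, hmn, ?_, ?_⟩
    · rw [inner_add_right, real_inner_self_eq_norm_sq, hm]
      linarith
    · rw [inner_add_right, real_inner_self_eq_norm_sq, hn, real_inner_comm]
      linarith

theorem intrinsicDist_frontier_ne_top [FiniteDimensional ℝ E] (hdim : 2 ≤ Module.finrank ℝ E)
    {P : Set E} (hcomp : IsCompact P) (hconv : Convex ℝ P) (hint : (interior P).Nonempty)
    {a b : E} (ha : a ∈ frontier P) (hb : b ∈ frontier P) :
    intrinsicDist (frontier P) a b ≠ ⊤ := by
  have hcl := hcomp.isClosed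
  have haP := hcl.frontier_subset ha
  have hbP := hcl.frontier_subset hb
  obtain ⟨π, hlip, hfix, hfr⟩ := exists_lipschitz_retraction_onto_frontier ⟨a, haP⟩ hcl hconv
  obtain ⟨m, hm⟩ := exists_isContainingHalfspace hconv hint ha
  obtain ⟨n, hn⟩ := exists_isContainingHalfspace hconv hint hb
  obtain ⟨e, he0, hme, hne⟩ := exists_ne_zero_inner_nonneg hdim hm.1 hn.1
  obtain ⟨M, hM⟩ := hcomp.exists_bound_of_continuousOn (f := fun y => ⟪e, y⟫) (by fun_prop)
  have hpos : 0 < ⟪e, e⟫ := real_inner_self_pos.2 he0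
  have hM0 : 0 ≤ M := (norm_nonneg _).trans (hM a haP)
  obtain ⟨R, hR0, hR⟩ : ∃ R : ℝ, 0 ≤ R ∧ 2 * M + 1 ≤ R * ⟪e, e⟫ :=
    ⟨(2 * M + 1) / ⟪e, e⟫, by positivity, by rw [div_mul_cancel₀ _ hpos.ne']⟩
  have hfar : ∀ y ∈ P, M + 1 ≤ ⟪e, y + R • e⟫ := by
    intro y hy
    have := neg_le_of_abs_le (hM y hy)
    rw [inner_add_right, real_inner_smul_right]
    linarith
  have h1 := intrinsicDist_frontier_le_edist hlip hfr (a := a) (b := a + R • e)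
    (hm.segment_disjoint_interior le_rfl (by
      rw [inner_add_right, real_inner_smul_right]
      nlinarith))
  have h2 := intrinsicDist_frontier_le_edist hlip hfr (a := a + R • e) (b := b + R • e)
    (by
      rintro z ⟨s, t, hs, ht, hst, rfl⟩ hz
      have h := le_of_abs_le (hM _ (interior_subset hz))
      rw [inner_add_right, real_inner_smul_right, real_inner_smul_right] at h
      nlinarith [hfar a haP, hfar b hbP])
  have h3 := intrinsicDist_frontier_le_edist hlip hfr (a := b + R • e) (b := b)
    (hn.segment_disjoint_interior (by
      rw [inner_add_right, real_inner_smul_right]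
      nlinarith) le_rfl)
  rw [hfix a haP] at h1
  rw [hfix b hbP] at h3
  have htri := (intrinsicDist_triangle (frontier P) a (π (a + R • e)) b).trans (add_le_add h1
    ((intrinsicDist_triangle (frontier P) _ (π (b + R • e)) b).trans (add_le_add h2 h3)))
  refine ne_top_of_le_ne_top ?_ htri
  simp [edist_ne_top]

end Supporting

section Unfolding

variable {E : Type*} [NormedAddCommGroup E] [InnerProductSpace ℝ E]

theorem norm_sub_le_of_ne_zero {u z : E} (hu : u ≠ 0) :
    ‖u - z‖ ≤ ‖u‖ - ⟪‖u‖⁻¹ • u, z⟫ + ‖z‖ ^ 2 / (2 * ‖u‖) := by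
  have hpos : 0 < ‖u‖ := norm_pos_iff.2 hu
  have h1 : ‖u - z‖ ^ 2 = ‖u‖ ^ 2 - 2 * ⟪u, z⟫ + ‖z‖ ^ 2 := norm_sub_sq_real u z
  rw [real_inner_smul_left]
  have h2 : ‖u - z‖ * (2 * ‖u‖) ≤ ‖u - z‖ ^ 2 + ‖u‖ ^ 2 := by
    nlinarith [sq_nonneg (‖u - z‖ - ‖u‖)]
  have h3 : ‖u‖ - ‖u‖⁻¹ * ⟪u, z⟫ + ‖z‖ ^ 2 / (2 * ‖u‖)
      = (‖u - z‖ ^ 2 + ‖u‖ ^ 2) / (2 * ‖u‖) := by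
    rw [h1]
    field_simp
    ring
  rw [h3, le_div_iff₀ (by positivity)]
  exact h2

theorem inner_unit_add_unit_eq_zero {u w z : E} (hu : u ≠ 0) (hw : w ≠ 0)
    (h : ∀ ε : ℝ, ‖u‖ + ‖w‖ ≤ ‖u - ε • z‖ + ‖w - ε • z‖) :
    ⟪‖u‖⁻¹ • u + ‖w‖⁻¹ • w, z⟫ = 0 := by
  set k := ⟪‖u‖⁻¹ • u + ‖w‖⁻¹ • w, z⟫ with hk
  set C := ‖z‖ ^ 2 / (2 * ‖u‖) + ‖z‖ ^ 2 / (2 * ‖w‖) with hC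
  have hC0 : 0 ≤ C := by positivity
  have key : ∀ ε : ℝ, 0 ≤ ε ^ 2 * C - ε * k := by
    intro ε
    have h1 := norm_sub_le_of_ne_zero (z := ε • z) hu
    have h2 := norm_sub_le_of_ne_zero (z := ε • z) hw
    rw [real_inner_smul_right, norm_smul, mul_pow, Real.norm_eq_abs, sq_abs] at h1 h2
    have h3 : ε ^ 2 * C - ε * k = ε ^ 2 * ‖z‖ ^ 2 / (2 * ‖u‖) + ε ^ 2 * ‖z‖ ^ 2 / (2 * ‖w‖)
        - ε * ⟪‖u‖⁻¹ • u, z⟫ - ε * ⟪‖w‖⁻¹ • w, z⟫ := by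
      rw [hC, hk, inner_add_left]
      ring
    linarith [h ε]
  have h1 := key (k / (C + 1))
  have h2 : (k / (C + 1)) ^ 2 * C - k / (C + 1) * k = - (k ^ 2 / (C + 1) ^ 2) := by
    field_simp
    ring
  rw [h2] at h1
  have h3 : 0 ≤ k ^ 2 / (C + 1) ^ 2 := by positivity
  have h4 : k ^ 2 / (C + 1) ^ 2 = 0 := by linarith
  have h5 : (C + 1) ^ 2 ≠ 0 := by positivity
  simpa [h5, div_eq_zero_iff] using h4

/-- If a broken line through a point of the edge `n₁⊥ ∩ n₂⊥` of a wedge cannot be shortened by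
moving its vertex along the edge, then it unfolds to a straight line. -/
theorem exists_unit_add_unit_eq_smul {n₁ n₂ u w : E} (hn₁ : ‖n₁‖ = 1) (hn₂ : ‖n₂‖ = 1)
    (hne : n₁ ≠ -n₂) (hu : u ≠ 0) (hw : w ≠ 0) (hu₁ : ⟪n₁, u⟫ = 0) (hw₂ : ⟪n₂, w⟫ = 0)
    (hw₁ : ⟪n₁, w⟫ ≤ 0) (hu₂ : ⟪n₂, u⟫ ≤ 0)
    (h : ∀ z, ⟪n₁, z⟫ = 0 → ⟪n₂, z⟫ = 0 → ‖u‖ + ‖w‖ ≤ ‖u - z‖ + ‖w - z‖) :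
    ∃ a : ℝ, a ≤ 0 ∧ ‖u‖⁻¹ • u + ‖w‖⁻¹ • w = a • (n₁ + n₂) := by
  set u' := ‖u‖⁻¹ • u with hu'
  set w' := ‖w‖⁻¹ • w with hw'
  have hu'n : ‖u'‖ = 1 := by
    rw [hu', norm_smul, norm_inv, norm_norm, inv_mul_cancel₀ (norm_ne_zero_iff.2 hu)]
  have hw'n : ‖w'‖ = 1 := by
    rw [hw', norm_smul, norm_inv, norm_norm, inv_mul_cancel₀ (norm_ne_zero_iff.2 hw)]
  have hu'₁ : ⟪n₁, u'⟫ = 0 := by rw [hu', real_inner_smul_right, hu₁, mul_zero]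
  have hw'₂ : ⟪n₂, w'⟫ = 0 := by rw [hw', real_inner_smul_right, hw₂, mul_zero]
  have hw'₁ : ⟪n₁, w'⟫ ≤ 0 := by
    rw [hw', real_inner_smul_right]
    exact mul_nonpos_of_nonneg_of_nonpos (by positivity) hw₁
  have hu'₂ : ⟪n₂, u'⟫ ≤ 0 := by
    rw [hu', real_inner_smul_right]
    exact mul_nonpos_of_nonneg_of_nonpos (by positivity) hu₂
  have hmem : u' + w' ∈ Submodule.span ℝ {n₁, n₂} := by
    have : FiniteDimensional ℝ (Submodule.span ℝ {n₁, n₂}) :=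
      FiniteDimensional.span_of_finite ℝ (Set.toFinite _)
    rw [← Submodule.orthogonal_orthogonal (Submodule.span ℝ {n₁, n₂}),
      Submodule.mem_orthogonal]
    intro z hz
    rw [Submodule.mem_orthogonal] at hz
    have hz₁ := hz n₁ (Submodule.subset_span (by simp))
    have hz₂ := hz n₂ (Submodule.subset_span (by simp))
    rw [real_inner_comm]
    refine inner_unit_add_unit_eq_zero hu hw fun ε => h _ ?_ ?_
    · rw [real_inner_smul_right, hz₁, mul_zero]
    · rw [real_inner_smul_right, hz₂, mul_zero]
  obtain ⟨a, b, hab⟩ := Submodule.mem_span_pair.1 hmem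
  set p := ⟪n₁, n₂⟫ with hp
  have hp1 : -1 < p := by
    refine lt_of_le_of_ne ?_ fun hp' => hne ?_
    · have := neg_le_of_abs_le (abs_real_inner_le_norm n₁ n₂)
      rwa [hn₁, hn₂, mul_one] at this
    · rwa [eq_comm, inner_eq_neg_one_iff_of_norm_eq_one hn₁ hn₂] at hp'
  have e1 : ⟪n₁, w'⟫ = a + b * p := by
    have := congrArg (fun x => ⟪n₁, x⟫) hab
    simp only [inner_add_right, real_inner_smul_right, real_inner_self_eq_norm_sq, hn₁, hu'₁]
      at this
    linarith
  have e2 : ⟪n₂, u'⟫ = a * p + b := by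
    have := congrArg (fun x => ⟪n₂, x⟫) hab
    simp only [inner_add_right, real_inner_smul_right, real_inner_self_eq_norm_sq, hn₂, hw'₂,
      real_inner_comm n₁ n₂] at this
    linarith
  have e3 : (b - a) * (b + a) = 0 := by
    have h1 : ⟪u' + w', u' - w'⟫ = 0 := by
      simp only [inner_add_left, inner_sub_right, real_inner_self_eq_norm_sq, hu'n, hw'n,
        real_inner_comm u' w']
      ring
    rw [← hab] at h1
    simp only [inner_add_left, inner_sub_right, real_inner_smul_left, hu'₁, hw'₂, e1, e2] at h1
    linarith
  have done : ∀ a' : ℝ, u' + w' = a' • (n₁ + n₂) → ∃ a : ℝ, a ≤ 0 ∧ u' + w' = a • (n₁ + n₂) := by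
    intro a' h'
    refine ⟨a', ?_, h'⟩
    have := congrArg (fun x => ⟪n₁, x⟫) h'
    simp only [inner_add_right, real_inner_smul_right, real_inner_self_eq_norm_sq, hn₁, hu'₁]
      at this
    by_contra! ha'
    nlinarith
  rcases mul_eq_zero.1 e3 with h0 | h0
  · obtain rfl : b = a := by linarith
    exact done b (by rw [← hab, smul_add])
  · obtain rfl : b = -a := by linarith
    by_cases ha : a = 0
    · exact done 0 (by rw [← hab, ha]; simp)
    · have hp' : p = 1 := by
        have h1 : a * (1 - p) = 0 := by nlinarith
        rcases mul_eq_zero.1 h1 with h2 | h2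
        · exact absurd h2 ha
        · linarith
      rw [hp, inner_eq_one_iff_of_norm_eq_one hn₁ hn₂] at hp'
      exact done 0 (by rw [← hab, hp']; simp)

theorem eq_of_add_eq_smul {n n' m u u' w : E} {a a' : ℝ} (hn : ‖n‖ = 1) (hn' : ‖n'‖ = 1)
    (hm : ‖m‖ = 1) (hnm : n ≠ -m) (hnm' : n' ≠ -m) (ha : a ≤ 0) (ha' : a' ≤ 0)
    (h : u + w = a • (n + m)) (h' : u' + w = a' • (n' + m)) (hu : ⟪n, u⟫ = 0)
    (hu' : ⟪n', u'⟫ = 0) (hnu' : ⟪n, u'⟫ ≤ 0) (hnu : ⟪n', u⟫ ≤ 0) : u = u' := by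
  have lower : ∀ k : E, ‖k‖ = 1 → k ≠ -m → -1 < ⟪k, m⟫ := by
    intro k hk hkm
    refine lt_of_le_of_ne ?_ fun hp' => hkm ?_
    · have := neg_le_of_abs_le (abs_real_inner_le_norm k m)
      rwa [hk, hm, mul_one] at this
    · rwa [eq_comm, inner_eq_neg_one_iff_of_norm_eq_one hk hm] at hp'
  have hp := lower n hn hnm
  have hp' := lower n' hn' hnm'
  have hq : ⟪n, n'⟫ ≤ 1 := by
    have := le_of_abs_le (abs_real_inner_le_norm n n')
    rwa [hn, hn', mul_one] at this
  have e1 := congrArg (fun x => ⟪n, x⟫) h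
  have e2 := congrArg (fun x => ⟪n', x⟫) h'
  have e3 := congrArg (fun x => ⟪n, x⟫) h'
  have e4 := congrArg (fun x => ⟪n', x⟫) h
  simp only [inner_add_right, real_inner_smul_right, real_inner_self_eq_norm_sq, hn, hn', hu, hu',
    real_inner_comm n n'] at e1 e2 e3 e4
  have i1 : -a * (1 + ⟪n, m⟫) ≤ -a' * (⟪n, n'⟫ + ⟪n, m⟫) := by nlinarith
  have i2 : -a' * (1 + ⟪n', m⟫) ≤ -a * (⟪n, n'⟫ + ⟪n', m⟫) := by nlinarith
  have j1 : -a ≤ -a' := by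
    by_contra! hlt
    nlinarith
  have j2 : -a' ≤ -a := by
    by_contra! hlt
    nlinarith
  obtain rfl : a = a' := by linarith
  rcases ha.eq_or_lt with rfl | hlt
  · rw [zero_smul] at h h'
    exact add_right_cancel (h.trans h'.symm)
  · have : ⟪n, n'⟫ = 1 := le_antisymm hq (by nlinarith)
    rw [inner_eq_one_iff_of_norm_eq_one hn hn'] at this
    rw [← this] at h'
    exact add_right_cancel (h.trans h'.symm)

theorem exists_unit_add_unit_eq_smul_of_edist_add_le [CompleteSpace E] {P : Set E}
    (hcl : IsClosed P) (hconv : Convex ℝ P) (hint : (interior P).Nonempty) {n m p x y : E}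
    {b c : ℝ} (hn : IsContainingHalfspace P n b) (hm : IsContainingHalfspace P m c)
    (hp : p ∈ P) (hy : y ∈ P) (hpx : p ≠ x) (hyx : y ≠ x) (hnp : ⟪n, p⟫ = b)
    (hnx : ⟪n, x⟫ = b) (hmx : ⟪m, x⟫ = c) (hmy : ⟪m, y⟫ = c)
    (h : edist p x + edist x y ≤ intrinsicDist (frontier P) p y) :
    ∃ a : ℝ, a ≤ 0 ∧ ‖p - x‖⁻¹ • (p - x) + ‖y - x‖⁻¹ • (y - x) = a • (n + m) := by
  refine exists_unit_add_unit_eq_smul hn.1 hm.1 (hn.ne_neg hm hint hnx hmx) (sub_ne_zero.2 hpx)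
    (sub_ne_zero.2 hyx) ?_ ?_ ?_ ?_ fun z hz hz' => ?_
  · rw [inner_sub_right]
    linarith
  · rw [inner_sub_right]
    linarith
  · rw [inner_sub_right]
    linarith [hn.2 y hy]
  · rw [inner_sub_right]
    linarith [hm.2 p hp]
  · have h2 := h.trans (intrinsicDist_frontier_le_edist_add_edist hcl hconv hn hm hp hy hnp hmy
      (z := x + z) (by rw [inner_add_right]; linarith) (by rw [inner_add_right]; linarith))
    simp only [edist_dist] at h2
    rw [← ENNReal.ofReal_add dist_nonneg dist_nonneg,
      ← ENNReal.ofReal_add dist_nonneg dist_nonneg,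
      ENNReal.ofReal_le_ofReal_iff (by positivity)] at h2
    rw [dist_comm x y, dist_comm _ y] at h2
    simpa only [dist_eq_norm, sub_sub] using h2

end Unfolding

section NonBranching

variable {E : Type*} [NormedAddCommGroup E] [InnerProductSpace ℝ E]

theorem exists_common_halfspace_of_mem_closure {S : Set E} {T : Set (E × ℝ)} (hT : T.Finite)
    (hcov : ∀ x ∈ S, ∃ p ∈ T, ⟪p.1, x⟫ = p.2) {γ : ℝ → E} {M I : Set ℝ} {t : ℝ}
    (hγ : ContinuousOn γ I) (hS : Set.MapsTo γ I S) (hMI : M ⊆ I) (ht : t ∈ I)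
    (htM : t ∈ closure M) : ∃ p ∈ T, ∃ s ∈ M, ⟪p.1, γ s⟫ = p.2 ∧ ⟪p.1, γ t⟫ = p.2 := by
  have : (nhdsWithin t M).NeBot := mem_closure_iff_nhdsWithin_neBot.1 htM
  by_contra! hcon
  have hev : ∀ p ∈ T, ∀ᶠ s in nhdsWithin t M, ⟪p.1, γ s⟫ ≠ p.2 := by
    intro p hp
    by_cases hpt : ⟪p.1, γ t⟫ = p.2
    · filter_upwards [self_mem_nhdsWithin] with s hs h
      exact hcon p hp s hs h hpt
    · have hc : ContinuousWithinAt (fun s => ⟪p.1, γ s⟫) M t :=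
        (continuousWithinAt_const.inner (hγ t ht)).mono hMI
      exact hc.eventually_ne hpt
  obtain ⟨s, hs, hsM⟩ := (((Filter.eventually_all_finite hT).2 hev).and self_mem_nhdsWithin).exists
  obtain ⟨p, hp, h⟩ := hcov _ (hS (hMI hsM))
  exact hs p hp h

theorem IsPathIn.exists_later_of_ne {S : Set E} {T : Set (E × ℝ)} (hT : T.Finite)
    (hcov : ∀ x ∈ S, ∃ p ∈ T, ⟪p.1, x⟫ = p.2) {a b : E} {γ : ℝ → E} (hγ : IsPathIn S a b γ)
    {t : ℝ} (ht : t ∈ Set.Icc (0 : ℝ) 1) (hne : γ t ≠ b) :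
    ∃ p ∈ T, ∃ s ∈ Set.Icc t 1, γ s ≠ γ t ∧ ⟪p.1, γ s⟫ = p.2 ∧ ⟪p.1, γ t⟫ = p.2 := by
  obtain ⟨hc, -, h1, hS⟩ := hγ
  have hsub := Set.Icc_subset_Icc_left (b := (1 : ℝ)) ht.1
  have hcl : IsClosed (Set.Icc t 1 ∩ γ ⁻¹' {γ t}) :=
    (hc.mono hsub).preimage_isClosed_of_isClosed isClosed_Icc isClosed_singleton
  obtain ⟨r, ⟨hr, hrt⟩, hmax⟩ := (isCompact_Icc.of_isClosed_subset hcl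
    Set.inter_subset_left).exists_isGreatest ⟨t, ⟨le_rfl, ht.2⟩, rfl⟩
  rw [Set.mem_preimage, Set.mem_singleton_iff] at hrt
  have hr1 : r < 1 := by
    refine lt_of_le_of_ne hr.2 ?_
    rintro rfl
    exact hne (hrt.symm.trans h1)
  obtain ⟨p, hp, s, hs, h⟩ := exists_common_halfspace_of_mem_closure hT hcov hc hS
    (M := Set.Ioc r 1) (t := r) (fun s hs => hsub ⟨hr.1.trans hs.1.le, hs.2⟩) (hsub hr) (by
      rw [closure_Ioc hr1.ne]
      exact ⟨le_rfl, hr1.le⟩)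
  rw [hrt] at h
  refine ⟨p, hp, s, ⟨hr.1.trans hs.1.le, hs.2⟩, fun hst => ?_, h⟩
  exact absurd (hmax ⟨⟨hr.1.trans hs.1.le, hs.2⟩, hst⟩) (not_le.2 hs.1)

theorem IsPathIn.exists_earlier_of_ne {S : Set E} {T : Set (E × ℝ)} (hT : T.Finite)
    (hcov : ∀ x ∈ S, ∃ p ∈ T, ⟪p.1, x⟫ = p.2) {a b : E} {γ : ℝ → E} (hγ : IsPathIn S a b γ)
    {t : ℝ} (ht : t ∈ Set.Icc (0 : ℝ) 1) (hne : γ t ≠ a) :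
    ∃ p ∈ T, ∃ s ∈ Set.Icc 0 t, γ s ≠ γ t ∧ ⟪p.1, γ s⟫ = p.2 ∧ ⟪p.1, γ t⟫ = p.2 := by
  obtain ⟨hc, h0, h1, hS⟩ := hγ
  have hmaps : Set.MapsTo (fun s : ℝ => 1 - s) (Set.Icc 0 1) (Set.Icc 0 1) := fun s hs =>
    ⟨by linarith [hs.2], by linarith [hs.1]⟩
  have hrev : IsPathIn S b a (γ ∘ fun s => 1 - s) :=
    ⟨hc.comp (by fun_prop) hmaps, by simp [h1], by simp [h0], hS.comp hmaps⟩
  obtain ⟨p, hp, s, hs, h⟩ := hrev.exists_later_of_ne hT hcov (hmaps ht) (by simpa using hne)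
  refine ⟨p, hp, 1 - s, ⟨by linarith [hs.2], by linarith [hs.1]⟩, ?_⟩
  simpa using h

theorem mem_segment_of_inv_norm_smul_eq {p q x y : E} (hqx : q ≠ x)
    (hdir : ‖p - x‖⁻¹ • (p - x) = ‖q - x‖⁻¹ • (q - x)) (hy : y ∈ segment ℝ p x)
    (hle : dist y x ≤ dist q x) : y ∈ segment ℝ q x := by
  rw [segment_symm, segment_eq_image'] at hy ⊢
  obtain ⟨θ, hθ, rfl⟩ := hy
  have hq0 : 0 < ‖q - x‖ := norm_pos_iff.2 (sub_ne_zero.2 hqx)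
  have hp : p - x = ‖p - x‖ • ‖q - x‖⁻¹ • (q - x) := by
    rw [← hdir, smul_smul]
    rcases eq_or_ne (p - x) 0 with h | h
    · simp [h]
    · rw [mul_inv_cancel₀ (norm_ne_zero_iff.2 h), one_smul]
  rw [dist_eq_norm, dist_eq_norm, add_sub_cancel_left, norm_smul, Real.norm_of_nonneg hθ.1] at hle
  refine ⟨θ * ‖p - x‖ * ‖q - x‖⁻¹, ⟨?_, ?_⟩, ?_⟩
  · have := hθ.1
    positivity
  · rw [← div_eq_mul_inv, div_le_one hq0]
    exact hle
  · conv_rhs => rw [hp]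
    simp only [smul_smul, mul_assoc]

/-- Nonbranching: shortest paths on a polytope boundary which extend beyond `c` as a shortest
path towards `w` are determined by their endpoints. -/
theorem image_subset_image_of_intrinsicDist_add {P : Set E} [CompleteSpace E] (hcl : IsClosed P)
    (hconv : Convex ℝ P) (hint : (interior P).Nonempty) {T : Set (E × ℝ)} (hT : T.Finite)
    (hTP : ∀ p ∈ T, IsContainingHalfspace P p.1 p.2)
    (hcov : ∀ x ∈ frontier P, ∃ p ∈ T, ⟪p.1, x⟫ = p.2)
    (hfin : ∀ a ∈ frontier P, ∀ b ∈ frontier P, intrinsicDist (frontier P) a b ≠ ⊤)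
    {v w c : E} {γ α β : ℝ → E} (hγ : IsShortestPath (frontier P) v w γ) {t₀ : ℝ}
    (ht₀ : t₀ ∈ Set.Icc (0 : ℝ) 1) (hc : c = γ t₀) (hcw : c ≠ w)
    (hα : IsShortestPath (frontier P) v c α) (hβ : IsShortestPath (frontier P) v c β) :
    α '' Set.Icc 0 1 ⊆ β '' Set.Icc 0 1 := by
  have hvS : v ∈ frontier P := hγ.1.2.1 ▸ hγ.1.2.2.2 (by simp)
  have hwS : w ∈ frontier P := hγ.1.2.2.1 ▸ hγ.1.2.2.2 (by simp)
  have hcS : c ∈ frontier P := hc ▸ hγ.1.2.2.2 ht₀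
  have hvw := hfin v hvS w hwS
  have hvc := hfin v hvS c hcS
  have hsub : frontier P ⊆ P := hcl.frontier_subset
  set S := frontier P with hS
  have hvcw : intrinsicDist S v c + intrinsicDist S c w = intrinsicDist S v w := by
    have := hγ.intrinsicDist_add hvw le_rfl ht₀.1 ht₀.2 le_rfl
    rwa [hγ.1.2.1, hγ.1.2.2.1, ← hc] at this
  set B := Set.Icc (0 : ℝ) 1 ∩ {t | α t ∉ β '' Set.Icc 0 1} with hB
  by_contra hnot
  have hBne : B.Nonempty := by
    obtain ⟨_, ⟨t, ht, rfl⟩, h⟩ := Set.not_subset.1 hnot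
    exact ⟨t, ht, h⟩
  have himcl : IsClosed (β '' Set.Icc 0 1) := (isCompact_Icc.image_of_continuousOn hβ.1.1).isClosed
  have hBbdd : BddAbove B := ⟨1, fun t ht => ht.1.2⟩
  set t₁ := sSup B with ht₁
  have hcloB : t₁ ∈ closure B := csSup_mem_closure hBne hBbdd
  have ht₁I : t₁ ∈ Set.Icc (0 : ℝ) 1 :=
    closure_minimal Set.inter_subset_left isClosed_Icc hcloB
  have hxβ : α t₁ ∈ β '' Set.Icc 0 1 := by
    by_contra hx
    have hlt : t₁ < 1 := by
      refine lt_of_le_of_ne ht₁I.2 fun h => hx ?_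
      rw [h, hα.1.2.2.1, ← hβ.1.2.2.1]
      exact ⟨1, by simp, rfl⟩
    have hcont : ContinuousWithinAt α (Set.Ioc t₁ 1) t₁ :=
      (hα.1.1 t₁ ht₁I).mono fun s hs => ⟨ht₁I.1.trans hs.1.le, hs.2⟩
    have : (nhdsWithin t₁ (Set.Ioc t₁ 1)).NeBot := by
      rw [← mem_closure_iff_nhdsWithin_neBot, closure_Ioc hlt.ne]
      exact ⟨le_rfl, hlt.le⟩
    obtain ⟨s, hs, hs'⟩ := ((hcont.eventually (himcl.isOpen_compl.mem_nhds hx)).and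
      self_mem_nhdsWithin).exists
    exact absurd (le_csSup hBbdd ⟨⟨ht₁I.1.trans hs'.1.le, hs'.2⟩, hs⟩) (not_le.2 hs'.1)
  have hBlt : ∀ s ∈ B, s < t₁ := by
    intro s hs
    refine lt_of_le_of_ne (le_csSup hBbdd hs) fun h => hs.2 ?_
    rw [h]
    exact hxβ
  obtain ⟨⟨n, b⟩, hnT, s, hsB, hns, hnx⟩ := exists_common_halfspace_of_mem_closure hT hcov
    hα.1.1 hα.1.2.2.2 Set.inter_subset_left ht₁I hcloB
  have hst := hBlt s hsB
  have hpx : α s ≠ α t₁ := fun h => hsB.2 (h ▸ hxβ)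
  obtain ⟨s₁, hs₁, hs₁x⟩ := hxβ
  have hn := hTP _ hnT
  have hxS : α t₁ ∈ S := hα.1.2.2.2 ht₁I
  have hpS : α s ∈ S := hα.1.2.2.2 hsB.1
  have hpxd := intrinsicDist_frontier_eq_edist hcl hconv hn (hsub hpS) (hsub hxS) hns hnx
  have hvpx := hα.intrinsicDist_add hvc le_rfl hsB.1.1 hst.le ht₁I.2
  have hvxc := hα.intrinsicDist_add hvc le_rfl ht₁I.1 ht₁I.2 le_rfl
  rw [hα.1.2.1] at hvpx hvxc
  rw [hα.1.2.2.1] at hvxc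
  have hxv : α t₁ ≠ v := by
    intro h
    have hvv := intrinsicDist_frontier_eq_edist hcl hconv hn (hsub hxS) (hsub hxS) hnx hnx
    rw [edist_self, h] at hvv
    rw [h, hvv, add_eq_zero] at hvpx
    refine hpx (edist_eq_zero.1 ?_)
    rw [← hpxd, h]
    exact hvpx.2
  obtain ⟨⟨n', b'⟩, hn'T, s₂, hs₂, hqx, hn's, hn'x⟩ := hβ.1.exists_earlier_of_ne hT hcov hs₁
    (hs₁x ▸ hxv)
  have hn' := hTP _ hn'T
  have hqS : β s₂ ∈ S := hβ.1.2.2.2 ⟨hs₂.1, hs₂.2.trans hs₁.2⟩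
  have hvqx := hβ.intrinsicDist_add hvc le_rfl hs₂.1 hs₂.2 hs₁.2
  have hqimg := hβ.segment_subset_image hvc hs₂.1 hs₂.2 hs₁.2
  rw [hs₁x] at hqx hn'x hvqx hqimg
  rw [hβ.1.2.1] at hvqx
  have hqxd := intrinsicDist_frontier_eq_edist hcl hconv hn' (hsub hqS) (hsub hxS) hn's hn'x
  have hxcw : intrinsicDist S v (α t₁) + intrinsicDist S (α t₁) w = intrinsicDist S v w := by
    refine le_antisymm ?_ (intrinsicDist_triangle _ _ _ _)
    rw [← hvcw, ← hvxc, add_assoc]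
    exact add_le_add le_rfl (intrinsicDist_triangle _ _ _ _)
  obtain ⟨y, hyS, ⟨m, e⟩, hmT, hyx, hmy, hmx, hxyw⟩ : ∃ y ∈ S, ∃ p ∈ T, y ≠ α t₁ ∧
      ⟪p.1, y⟫ = p.2 ∧ ⟪p.1, α t₁⟫ = p.2 ∧ intrinsicDist S (α t₁) y + intrinsicDist S y w
        = intrinsicDist S (α t₁) w := by
    by_cases hxc : α t₁ = c
    · rw [hxc, hc]
      obtain ⟨p, hp, r, hr, h1, h2, h3⟩ := hγ.1.exists_later_of_ne hT hcov ht₀ (hc ▸ hcw)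
      refine ⟨γ r, hγ.1.2.2.2 ⟨ht₀.1.trans hr.1, hr.2⟩, p, hp, h1, h2, h3, ?_⟩
      have := hγ.intrinsicDist_add hvw ht₀.1 hr.1 hr.2 le_rfl
      rwa [hγ.1.2.2.1] at this
    · obtain ⟨p, hp, r, hr, h1, h2, h3⟩ := hα.1.exists_later_of_ne hT hcov ht₁I hxc
      have hyS : α r ∈ S := hα.1.2.2.2 ⟨ht₁I.1.trans hr.1, hr.2⟩
      refine ⟨α r, hyS, p, hp, h1, h2, h3, le_antisymm ?_ (intrinsicDist_triangle _ _ _ _)⟩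
      have h4 := hα.intrinsicDist_add hvc ht₁I.1 hr.1 hr.2 le_rfl
      rw [hα.1.2.2.1] at h4
      rw [← ENNReal.add_le_add_iff_left (hfin v hvS _ hxS), hxcw, ← hvcw, ← hvxc, ← h4]
      simp only [add_assoc]
      gcongr
      exact intrinsicDist_triangle _ _ _ _
  have hm := hTP _ hmT
  have hxyd := intrinsicDist_frontier_eq_edist hcl hconv hm (hsub hxS) (hsub hyS) hmx hmy
  have straight : ∀ z ∈ S, intrinsicDist S v z + intrinsicDist S z (α t₁)
      = intrinsicDist S v (α t₁) → intrinsicDist S z (α t₁) = edist z (α t₁) →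
      edist z (α t₁) + edist (α t₁) y ≤ intrinsicDist S z y := by
    intro z hz h1 h2
    rw [← h2, ← hxyd, ← ENNReal.add_le_add_iff_left (hfin v hvS z hz),
      ← ENNReal.add_le_add_iff_right (hfin y hyS w hwS), ← add_assoc, h1, add_assoc, hxyw, hxcw,
      add_assoc]
    exact (intrinsicDist_triangle _ _ z _).trans
      (add_le_add le_rfl (intrinsicDist_triangle _ _ _ _))
  obtain ⟨a, ha, hadir⟩ := exists_unit_add_unit_eq_smul_of_edist_add_le hcl hconv hint hn hm
    (hsub hpS) (hsub hyS) hpx hyx hns hnx hmx hmy (straight _ hpS hvpx hpxd)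
  obtain ⟨a', ha', hadir'⟩ := exists_unit_add_unit_eq_smul_of_edist_add_le hcl hconv hint hn' hm
    (hsub hqS) (hsub hyS) hqx hyx hn's hn'x hmx hmy (straight _ hqS hvqx hqxd)
  have hsupp : ∀ {k z : E} {l : ℝ}, IsContainingHalfspace P k l → z ∈ P → ⟪k, α t₁⟫ = l →
      ⟪k, ‖z - α t₁‖⁻¹ • (z - α t₁)⟫ ≤ 0 := by
    intro k z l hk hz hkx
    rw [real_inner_smul_right, inner_sub_right]
    exact mul_nonpos_of_nonneg_of_nonpos (by positivity) (by linarith [hk.2 z hz])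
  have hdir := eq_of_add_eq_smul hn.1 hn'.1 hm.1 (hn.ne_neg hm hint hnx hmx)
    (hn'.ne_neg hm hint hn'x hmx) ha ha' hadir hadir'
    (by rw [real_inner_smul_right, inner_sub_right, hns, hnx, sub_self, mul_zero])
    (by rw [real_inner_smul_right, inner_sub_right, hn's, hn'x, sub_self, mul_zero])
    (hsupp hn (hsub hqS) hnx) (hsupp hn' (hsub hpS) hn'x)
  have hnear : ∀ᶠ r in nhdsWithin t₁ B, dist (α r) (α t₁) < dist (β s₂) (α t₁) ∧ s < r := by
    have hcont : ContinuousWithinAt (fun r => dist (α r) (α t₁)) B t₁ :=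
      ((by fun_prop : Continuous fun z => dist z (α t₁)).continuousAt.comp_continuousWithinAt
        (hα.1.1 t₁ ht₁I)).mono Set.inter_subset_left
    refine (hcont.eventually (Iio_mem_nhds ?_)).and
      (Filter.Eventually.filter_mono nhdsWithin_le_nhds (Ioi_mem_nhds hst))
    simpa using hqx
  have : (nhdsWithin t₁ B).NeBot := mem_closure_iff_nhdsWithin_neBot.1 hcloB
  obtain ⟨r, ⟨hr, hsr⟩, hrB⟩ := (hnear.and self_mem_nhdsWithin).exists
  exact hrB.2 (hqimg hqxd (mem_segment_of_inv_norm_smul_eq hqx hdir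
    (hα.mem_segment_of_intrinsicDist_eq hvc hsB.1.1 hsr.le (hBlt r hrB).le ht₁I.2 hpxd) hr.le))

end NonBranching


/-- Corollary 2.2: no shortest path in `S = frontier P` to the source point `v`
(lying in the relative interior of a facet) has a cut point in its relative
interior: if `c = γ t₀` is an interior point of a shortest path `γ` from `v` to
`w`, distinct from both endpoints, then any two shortest paths in `S` from `v`
to `c` have the same image. -/
theorem no_cut_point_in_interior_of_shortest_path {d : ℕ} (hd : 1 ≤ d)
    (P : Set (EuclideanSpace ℝ (Fin (d + 1))))
    (hP : ∃ A : Finset (EuclideanSpace ℝ (Fin (d + 1))),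
      P = convexHull ℝ (A : Set (EuclideanSpace ℝ (Fin (d + 1)))))
    (hint : (interior P).Nonempty)
    (v : EuclideanSpace ℝ (Fin (d + 1)))
    (hv : ∃ F : Set (EuclideanSpace ℝ (Fin (d + 1))),
      IsFace P F ∧ faceDim F = d ∧ v ∈ intrinsicInterior ℝ F)
    (w : EuclideanSpace ℝ (Fin (d + 1)))
    (γ : ℝ → EuclideanSpace ℝ (Fin (d + 1)))
    (hγ : IsShortestPath (frontier P) v w γ)
    (t₀ : ℝ) (ht₀ : t₀ ∈ Set.Ioo (0 : ℝ) 1)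
    (c : EuclideanSpace ℝ (Fin (d + 1))) (hc : c = γ t₀)
    (hcv : c ≠ v) (hcw : c ≠ w) :
    ∀ γ₁ γ₂ : ℝ → EuclideanSpace ℝ (Fin (d + 1)),
      IsShortestPath (frontier P) v c γ₁ → IsShortestPath (frontier P) v c γ₂ →
        γ₁ '' Set.Icc 0 1 = γ₂ '' Set.Icc 0 1 := by
  obtain ⟨A, rfl⟩ := hP
  have hcomp : IsCompact (convexHull ℝ (A : Set (EuclideanSpace ℝ (Fin (d + 1))))) :=
    A.finite_toSet.isCompact_convexHull ℝ
  have hconv := convex_convexHull ℝ (A : Set (EuclideanSpace ℝ (Fin (d + 1))))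
  obtain ⟨T, hT, hTP, hcov⟩ := exists_finite_isContainingHalfspace hint
  have hdim : 2 ≤ Module.finrank ℝ (EuclideanSpace ℝ (Fin (d + 1))) := by
    rw [finrank_euclideanSpace_fin]
    omega
  have hfin := fun a ha b hb => intrinsicDist_frontier_ne_top hdim hcomp hconv hint (a := a)
    (b := b) ha hb
  intro γ₁ γ₂ h₁ h₂
  have ht := Set.Ioo_subset_Icc_self ht₀
  exact Set.Subset.antisymm
    (image_subset_image_of_intrinsicDist_add hcomp.isClosed hconv hint hT hTP hcov hfin hγ ht hc
      hcw h₁ h₂)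
    (image_subset_image_of_intrinsicDist_add hcomp.isClosed hconv hint hT hTP hcov hfin hγ ht hc
      hcw h₂ h₁)
end
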